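/- arXiv:1610.07334 — 3 statements merged into one kernel-verified Lean document; each statement's English description precedes it below -/
import Mathlib

section
/- Assmus–Mattson theorem: Let C be a linear code of length n over the finite field F_q (a linear subspace of F_q^n) with 0 ≠ C ≠ F_q^n, with minimum weight δ = min{wt(x) : x ∈ C, x ≠ 0}. Let C^⊥ = {y ∈ F_q^n : Σ_ℓ x_ℓ y_ℓ = 0 for all x ∈ C} be the dual code, with minimum weight δ* = min{wt(y) : y ∈ C^⊥, y ≠ 0}. Suppose an integer t with 1 ≤ t ≤ n is such that either |{w : 1 ≤ w ≤ n−t and some y ∈ C^⊥ has wt(y) = w}| ≤ δ − t, or |{w : 1 ≤ w ≤ n−t and some x ∈ C has wt(x) = w}| ≤ δ* − t (inequalities of integers). Then for every w with 0 ≤ w ≤ n, the multiset {supp(x) : x ∈ C, wt(x) = w} (the w-element subset supp(x) counted once for each codeword x of weight w) is a t-design with blocks of size w. -/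
open Finset
open scoped Classical

noncomputable section

/-- Hamming weight of a word over a field, relative to `0`. -/
def wt {F : Type} [Field F] {n : ℕ} (x : Fin n → F) : ℕ :=
  (univ.filter fun ℓ => x ℓ ≠ 0).card

/-- Support of a word over a field, relative to `0`. -/
def supp {F : Type} [Field F] {n : ℕ} (x : Fin n → F) : Finset (Fin n) :=
  univ.filter fun ℓ => x ℓ ≠ 0

theorem wt_eq_card_supp {F : Type} [Field F] {n : ℕ} (x : Fin n → F) :
    wt x = (supp x).card := rfl

theorem supp_zero {F : Type} [Field F] {n : ℕ} : supp (0 : Fin n → F) = ∅ := by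
  simp [supp]

theorem supp_eq_empty {F : Type} [Field F] {n : ℕ} {x : Fin n → F} :
    supp x = ∅ ↔ x = 0 := by
  simp [supp, Finset.filter_eq_empty_iff, funext_iff]

/-- On sets of size at most `t`, the value of `f` depends only on the size. -/
def CardDetermined {n : ℕ} (t : ℕ) (f : Finset (Fin n) → ℤ) : Prop :=
  ∀ T T' : Finset (Fin n), T.card = T'.card → T.card ≤ t → f T = f T'

theorem CardDetermined.exists_eq {n t : ℕ} {f : Finset (Fin n) → ℤ}
    (hf : CardDetermined t f) : ∃ c : ℕ → ℤ, ∀ T, T.card ≤ t → f T = c T.card := by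
  refine ⟨fun a => if h : ∃ T : Finset (Fin n), T.card = a then f h.choose else 0,
    fun T hT => ?_⟩
  have h : ∃ T' : Finset (Fin n), T'.card = T.card := ⟨T, rfl⟩
  simp only [dif_pos h]
  exact hf _ _ h.choose_spec.symm hT

theorem sum_disjoint_eq_sum_powerset {n : ℕ} (G : Finset (Fin n) → ℤ) (T : Finset (Fin n)) :
    ∑ U with Disjoint T U, G U =
      ∑ R ∈ T.powerset, (-1) ^ R.card * ∑ U with R ⊆ U, G U := by
  simp_rw [Finset.mul_sum, Finset.sum_filter]
  rw [Finset.sum_comm]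
  refine Finset.sum_congr rfl fun U _ => ?_
  have hfilter : T.powerset.filter (· ⊆ U) = (T ∩ U).powerset := by
    ext R
    rw [Finset.mem_filter, Finset.mem_powerset, Finset.mem_powerset, Finset.subset_inter_iff]
  rw [← Finset.sum_filter, hfilter, ← Finset.sum_mul, Finset.sum_powerset_neg_one_pow_card]
  simp [Finset.disjoint_iff_inter_eq_empty]

/-- Inclusion-exclusion: regularity over supersets gives regularity over disjoint sets. -/
theorem CardDetermined.sum_disjoint {n t : ℕ} {G : Finset (Fin n) → ℤ}
    (hG : CardDetermined t fun T => ∑ U with T ⊆ U, G U) :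
    CardDetermined t fun T => ∑ U with Disjoint T U, G U := by
  obtain ⟨c, hc⟩ := hG.exists_eq
  have key : ∀ T : Finset (Fin n), T.card ≤ t →
      ∑ U with Disjoint T U, G U =
        ∑ m ∈ Finset.range (T.card + 1), T.card.choose m • ((-1) ^ m * c m) := by
    intro T hT
    rw [sum_disjoint_eq_sum_powerset,
      ← Finset.sum_powerset_apply_card (fun m => (-1 : ℤ) ^ m * c m)]
    refine Finset.sum_congr rfl fun R hR => ?_
    rw [hc R ((Finset.card_le_card (Finset.mem_powerset.1 hR)).trans hT)]
  intro T T' h hT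
  change ∑ U with Disjoint T U, G U = ∑ U with Disjoint T' U, G U
  rw [key T hT, key T' (h ▸ hT), h]

/-- A function on a set of at most `m` distinct naturals is determined by its first `m`
binomial moments. -/
theorem eq_zero_of_sum_mul_choose_eq_zero (m : ℕ) (J : Finset ℕ) (x : ℕ → ℕ)
    (hx : Set.InjOn x J) (h : ℕ → ℤ) (hJ : J.card ≤ m)
    (hsum : ∀ i < m, ∑ j ∈ J, h j * ((x j).choose i : ℤ) = 0) :
    ∀ j ∈ J, h j = 0 := by
  induction J using Finset.induction_on generalizing m h with
  | empty => simp
  | insert a J ha ih =>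
    rw [Finset.card_insert_of_notMem ha] at hJ
    have hrest : ∀ j ∈ J, h j * ((x j : ℤ) - x a) = 0 := by
      refine ih (m - 1) (hx.mono (by simp)) _ (by omega) fun i hi => ?_
      have h1 := hsum i (by omega)
      have h2 := hsum (i + 1) (by omega)
      have hstep : ∀ j, h j * ((x j : ℤ) - x a) * ((x j).choose i : ℤ) =
          (i + 1) * (h j * ((x j).choose (i + 1) : ℤ)) +
            (i - x a) * (h j * ((x j).choose i : ℤ)) := by
        intro j
        have hrec : ((x j).choose (i + 1) : ℤ) * (i + 1) = (x j).choose i * ((x j : ℤ) - i) := by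
          rcases le_or_gt i (x j) with hij | hij
          · have := Nat.choose_succ_right_eq (x j) i
            zify [hij] at this
            exact this
          · simp [Nat.choose_eq_zero_of_lt hij, Nat.choose_eq_zero_of_lt (hij.trans i.lt_succ_self)]
        linear_combination (-h j) * hrec
      have hall : ∑ j ∈ insert a J, h j * ((x j : ℤ) - x a) * ((x j).choose i : ℤ) = 0 := by
        simp_rw [hstep]
        rw [Finset.sum_add_distrib, ← Finset.mul_sum, ← Finset.mul_sum, h1, h2]
        ring
      rw [Finset.sum_insert ha] at hall
      simpa using hall
    have hJ0 : ∀ j ∈ J, h j = 0 := by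
      intro j hj
      refine (mul_eq_zero.1 (hrest j hj)).resolve_right fun h0 => ha ?_
      have : j = a := hx (by simp [hj]) (by simp) (by exact_mod_cast sub_eq_zero.1 h0)
      exact this ▸ hj
    have h0 := hsum 0 (by omega)
    rw [Finset.sum_insert ha, Finset.sum_eq_zero fun j hj => by rw [hJ0 j hj, zero_mul]] at h0
    intro j hj
    rcases Finset.mem_insert.1 hj with rfl | hj
    · simpa using h0
    · exact hJ0 j hj

theorem card_supersets_disjoint {n : ℕ} {S T : Finset (Fin n)} (hST : Disjoint S T)
    {v : ℕ} (hv : T.card ≤ v) :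
    (univ.filter fun V : Finset (Fin n) => T ⊆ V ∧ V.card = v ∧ Disjoint S V).card =
      (n - T.card - S.card).choose (v - T.card) := by
  have hcard : (T ∪ S)ᶜ.card = n - T.card - S.card := by
    rw [Finset.card_compl, Fintype.card_fin, Finset.card_union_of_disjoint hST.symm]
    omega
  rw [← hcard, ← Finset.card_powersetCard]
  refine Finset.card_nbij' (· \ T) (· ∪ T) ?_ ?_ ?_ ?_
  · intro V hV
    simp only [coe_filter, mem_univ, true_and, Set.mem_ofPred_eq] at hV
    obtain ⟨h1, h2, h3⟩ := hV
    simp only [mem_coe, mem_powersetCard]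
    refine ⟨fun a ha => ?_, by rw [Finset.card_sdiff_of_subset h1, h2]⟩
    have := Finset.disjoint_right.1 h3 (Finset.mem_sdiff.1 ha).1
    simp_all
  · intro W hW
    simp only [mem_coe, mem_powersetCard] at hW
    obtain ⟨h1, h2⟩ := hW
    have hWc : Disjoint W (T ∪ S) := Finset.subset_compl_iff_disjoint_right.1 h1
    rw [Finset.disjoint_union_right] at hWc
    simp only [coe_filter, mem_univ, true_and, Set.mem_ofPred_eq]
    refine ⟨Finset.subset_union_right, ?_, Finset.disjoint_union_right.2 ⟨hWc.2.symm, hST⟩⟩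
    rw [Finset.card_union_of_disjoint hWc.1, h2]
    omega
  · intro V hV
    simp only [coe_filter, mem_univ, true_and, Set.mem_ofPred_eq] at hV
    exact Finset.sdiff_union_of_subset hV.1
  · intro W hW
    simp only [mem_coe, mem_powersetCard] at hW
    have hWc : Disjoint W (T ∪ S) := Finset.subset_compl_iff_disjoint_right.1 hW.1
    exact Finset.union_sdiff_cancel_right (Finset.disjoint_union_right.1 hWc).1

section Words

variable {F : Type} [Field F] {n : ℕ}

/-- The number of words in `P` vanishing on `S`. -/
def vanishCount (P : Finset (Fin n → F)) (S : Finset (Fin n)) : ℤ :=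
  (P.filter fun x => Disjoint (supp x) S).card

/-- The number of words in `P` of weight `j` vanishing on `S`. -/
def vanishWtCount (P : Finset (Fin n → F)) (j : ℕ) (S : Finset (Fin n)) : ℤ :=
  (P.filter fun x => wt x = j ∧ Disjoint (supp x) S).card

theorem card_add_wt_le {x : Fin n → F} {T : Finset (Fin n)} (h : Disjoint (supp x) T) :
    T.card + wt x ≤ n := by
  rw [wt_eq_card_supp, add_comm, ← Finset.card_union_of_disjoint h]
  simpa using Finset.card_le_univ (supp x ∪ T)

theorem sum_supersets_vanishCount (P : Finset (Fin n → F)) (T : Finset (Fin n)) {v : ℕ}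
    (hv : T.card ≤ v) :
    ∑ V with T ⊆ V ∧ V.card = v, vanishCount P V =
      ∑ j ∈ Finset.range (n - T.card + 1),
        vanishWtCount P j T * ((n - T.card - j).choose (v - T.card) : ℤ) := by
  have hleft : ∑ V with T ⊆ V ∧ V.card = v, vanishCount P V =
      ∑ x ∈ P with Disjoint (supp x) T, ((n - T.card - wt x).choose (v - T.card) : ℤ) := by
    simp_rw [vanishCount, Finset.card_filter, Nat.cast_sum]
    rw [Finset.sum_comm, Finset.sum_filter]
    refine Finset.sum_congr rfl fun x _ => ?_
    split_ifs with hx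
    · rw [wt_eq_card_supp, ← card_supersets_disjoint hx hv, ← Nat.cast_sum,
        ← Finset.card_filter, Finset.filter_filter]
      simp only [and_assoc]
    · refine Finset.sum_eq_zero fun V hV => ?_
      have hV' := (Finset.mem_filter.1 hV).2.1
      rw [if_neg fun h => hx (h.mono_right hV'), Nat.cast_zero]
  rw [hleft]
  have hmaps : ∀ x ∈ P.filter (fun x => Disjoint (supp x) T),
      wt x ∈ Finset.range (n - T.card + 1) := by
    intro x hx
    have := card_add_wt_le (Finset.mem_filter.1 hx).2
    rw [Finset.mem_range]
    omega
  rw [← Finset.sum_fiberwise_of_maps_to hmaps]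
  refine Finset.sum_congr rfl fun j _ => ?_
  rw [Finset.sum_congr rfl fun x hx => by rw [(Finset.mem_filter.1 hx).2], Finset.sum_const,
    Finset.filter_filter, nsmul_eq_mul, vanishWtCount]
  simp only [and_comm]

theorem vanishWtCount_eq_zero {P : Finset (Fin n → F)} {j : ℕ} {T : Finset (Fin n)}
    (hj : n - T.card < j ∨ ∀ x ∈ P, wt x ≠ j) : vanishWtCount P j T = 0 := by
  rw [vanishWtCount, Nat.cast_eq_zero, Finset.card_eq_zero, Finset.filter_eq_empty_iff]
  rintro x hx ⟨rfl, h⟩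
  have := card_add_wt_le h
  rcases hj with hj | hj
  · omega
  · exact hj x hx rfl

theorem vanishWtCount_zero {P : Finset (Fin n → F)} (h0 : (0 : Fin n → F) ∈ P)
    (T : Finset (Fin n)) : vanishWtCount P 0 T = 1 := by
  have : (P.filter fun x => wt x = 0 ∧ Disjoint (supp x) T) = {0} := by
    ext x
    simp only [Finset.mem_filter, Finset.mem_singleton, wt_eq_card_supp, Finset.card_eq_zero,
      supp_eq_empty]
    constructor
    · exact fun h => h.2.1
    · rintro rfl
      exact ⟨h0, rfl, by simp [supp_zero]⟩
  rw [vanishWtCount, this]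
  simp

/-- The MacWilliams relation between words of `P` vanishing on `S` and words of `Q`
supported on `S`. -/
def MacWilliams (q : ℕ) (P Q : Finset (Fin n → F)) : Prop :=
  ∀ S : Finset (Fin n), vanishCount P S * Q.card = vanishCount Q Sᶜ * (q : ℤ) ^ (n - S.card)

theorem vanishCount_compl_eq_one {Q : Finset (Fin n → F)} {d : ℕ} (h0 : (0 : Fin n → F) ∈ Q)
    (hd : ∀ y ∈ Q, y ≠ 0 → d ≤ wt y) {S : Finset (Fin n)} (hS : S.card < d) :
    vanishCount Q Sᶜ = 1 := by
  have : (Q.filter fun x => Disjoint (supp x) Sᶜ) = {0} := by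
    ext x
    simp only [Finset.mem_filter, Finset.mem_singleton]
    constructor
    · rintro ⟨hx, hxS⟩
      by_contra hne
      have h1 := hd x hx hne
      have h2 := Finset.card_le_card (disjoint_compl_right_iff.1 hxS)
      rw [wt_eq_card_supp] at h1
      exact absurd (h1.trans h2) (by omega)
    · rintro rfl
      exact ⟨h0, by simp [supp_zero]⟩
  rw [vanishCount, this]
  simp

theorem card_weights_add_le {P : Finset (Fin n → F)} {a t d : ℕ} (hat : a ≤ t)
    (hJ : ((Finset.Icc 1 (n - t)).filter fun w => ∃ x ∈ P, wt x = w).card + t ≤ d) :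
    ((Finset.Icc 1 (n - a)).filter fun w => ∃ x ∈ P, wt x = w).card + a ≤ d := by
  have hsub : ((Finset.Icc 1 (n - a)).filter fun w => ∃ x ∈ P, wt x = w) ⊆
      ((Finset.Icc 1 (n - t)).filter fun w => ∃ x ∈ P, wt x = w) ∪
        Finset.Ioc (n - t) (n - a) := by
    intro w hw
    simp only [Finset.mem_union, Finset.mem_filter, Finset.mem_Icc, Finset.mem_Ioc] at hw ⊢
    by_cases h : w ≤ n - t
    · exact Or.inl ⟨⟨hw.1.1, h⟩, hw.2⟩
    · exact Or.inr ⟨by omega, hw.1.2⟩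
  have h1 := (Finset.card_le_card hsub).trans (Finset.card_union_le _ _)
  rw [Nat.card_Ioc] at h1
  omega

/-- If `P` has few weights compared with the minimum weight of its dual `Q`, then the number
of words of each weight vanishing on a small set depends only on the size of that set. -/
theorem MacWilliams.cardDetermined_vanishWtCount {q : ℕ} {P Q : Finset (Fin n → F)}
    (hPQ : MacWilliams q P Q) (hP : (0 : Fin n → F) ∈ P) (hQ : (0 : Fin n → F) ∈ Q) {t d : ℕ}
    (hd : ∀ y ∈ Q, y ≠ 0 → d ≤ wt y)
    (hJ : ((Finset.Icc 1 (n - t)).filter fun w => ∃ x ∈ P, wt x = w).card + t ≤ d) (j : ℕ) :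
    CardDetermined t (vanishWtCount P j) := by
  intro T T' hTT hT
  set J := (Finset.Icc 1 (n - T.card)).filter fun w => ∃ x ∈ P, wt x = w
  have hJT : J.card + T.card ≤ d := card_weights_add_le hT hJ
  have hQpos : (Q.card : ℤ) ≠ 0 := by
    exact_mod_cast (Finset.card_pos.2 ⟨0, hQ⟩).ne'
  have hmoment : ∀ R : Finset (Fin n), R.card = T.card → ∀ i < d - T.card,
      (∑ V with R ⊆ V ∧ V.card = T.card + i, vanishCount P V) * Q.card =
        (n - T.card).choose i * (q : ℤ) ^ (n - (T.card + i)) := by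
    intro R hR i hi
    rw [Finset.sum_mul, Finset.sum_congr rfl (g := fun _ => (q : ℤ) ^ (n - (T.card + i)))]
    · rw [Finset.sum_const, nsmul_eq_mul]
      have := card_supersets_disjoint (Finset.disjoint_empty_left R)
        (v := T.card + i) (by omega)
      simp only [Finset.disjoint_empty_left, and_true, Finset.card_empty, hR, Nat.sub_zero,
        Nat.add_sub_cancel_left] at this
      rw [this]
    · intro V hV
      have hV' := (Finset.mem_filter.1 hV).2.2
      rw [hPQ V, vanishCount_compl_eq_one hQ hd (by omega), one_mul, hV']
  have hoff : ∀ k, k ≠ 0 → k ∉ J → ∀ R : Finset (Fin n), R.card = T.card →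
      vanishWtCount P k R = 0 := by
    intro k hk0 hkJ R hR
    refine vanishWtCount_eq_zero ?_
    by_contra! hcon
    obtain ⟨h1, x, hx, hxk⟩ := hcon
    exact hkJ (Finset.mem_filter.2 ⟨Finset.mem_Icc.2 ⟨by omega, by omega⟩, x, hx, hxk⟩)
  have hzero : ∀ k, k ∉ J → vanishWtCount P k T - vanishWtCount P k T' = 0 := by
    intro k hkJ
    rcases eq_or_ne k 0 with rfl | hk
    · rw [vanishWtCount_zero hP, vanishWtCount_zero hP, sub_self]
    · rw [hoff k hk hkJ T rfl, hoff k hk hkJ T' hTT.symm, sub_self]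
  rw [← sub_eq_zero]
  by_cases hjJ : j ∈ J
  swap
  · exact hzero j hjJ
  refine eq_zero_of_sum_mul_choose_eq_zero (d - T.card) J (fun k => n - T.card - k) ?_
    (fun k => vanishWtCount P k T - vanishWtCount P k T') (by omega) (fun i hi => ?_) j hjJ
  · intro k hk l hl hkl
    have hk' := Finset.mem_Icc.1 (Finset.mem_filter.1 hk).1
    have hl' := Finset.mem_Icc.1 (Finset.mem_filter.1 hl).1
    simp only at hkl
    omega
  · have hsub : J ⊆ Finset.range (n - T.card + 1) := by
      intro k hk
      have hk' := Finset.mem_Icc.1 (Finset.mem_filter.1 hk).1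
      exact Finset.mem_range.2 (by omega)
    rw [Finset.sum_subset hsub fun k _ hk => by rw [hzero k hk, zero_mul]]
    have h1 := sum_supersets_vanishCount P T (v := T.card + i) (by omega)
    have h2 := sum_supersets_vanishCount P T' (v := T.card + i) (by omega)
    have h3 := mul_right_cancel₀ hQpos
      ((hmoment T rfl i hi).trans (hmoment T' hTT.symm i hi).symm)
    rw [h1, h2, ← hTT, Nat.add_sub_cancel_left, ← sub_eq_zero, ← Finset.sum_sub_distrib] at h3
    simpa only [sub_mul] using h3

theorem cardDetermined_sum_supersets {P : Finset (Fin n → F)} {t : ℕ}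
    (hP : ∀ j, CardDetermined t (vanishWtCount P j)) (v : ℕ) :
    CardDetermined t fun T => ∑ V with T ⊆ V ∧ V.card = v, vanishCount P V := by
  intro T T' hTT hT
  rcases le_or_gt T.card v with hv | hv
  · simp only
    rw [sum_supersets_vanishCount P T hv, sum_supersets_vanishCount P T' (hTT ▸ hv), hTT]
    exact Finset.sum_congr rfl fun j _ => by rw [hP j T T' hTT hT]
  · have hempty : ∀ R : Finset (Fin n), R.card = T.card →
        (univ.filter fun V : Finset (Fin n) => R ⊆ V ∧ V.card = v) = ∅ := by
      intro R hR
      refine Finset.filter_eq_empty_iff.2 ?_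
      rintro V - ⟨h1, h2⟩
      have := Finset.card_le_card h1
      omega
    simp only
    rw [hempty T rfl, hempty T' hTT.symm]

theorem cardDetermined_vanishWtCount_of_sum {P : Finset (Fin n → F)} {t : ℕ}
    (hP : ∀ v ≤ n, CardDetermined t fun T => ∑ V with T ⊆ V ∧ V.card = v, vanishCount P V)
    (j : ℕ) : CardDetermined t (vanishWtCount P j) := by
  intro T T' hTT hT
  have hTn : T.card ≤ n := by simpa using Finset.card_le_univ T
  rcases lt_or_ge (n - T.card) j with hj | hj
  · rw [vanishWtCount_eq_zero (Or.inl hj), vanishWtCount_eq_zero (Or.inl (hTT ▸ hj))]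
  rw [← sub_eq_zero]
  refine eq_zero_of_sum_mul_choose_eq_zero (n - T.card + 1) (Finset.range (n - T.card + 1))
    (fun k => n - T.card - k) ?_ (fun k => vanishWtCount P k T - vanishWtCount P k T')
    (by simp) (fun i hi => ?_) j (Finset.mem_range.2 (by omega))
  · intro k hk l hl hkl
    simp only [Finset.coe_range, Set.mem_Iio] at hk hl hkl
    omega
  · have h1 := sum_supersets_vanishCount P T (v := T.card + i) (by omega)
    have h2 := sum_supersets_vanishCount P T' (v := T.card + i) (by omega)
    have h3 := hP (T.card + i) (by omega) T T' hTT hT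
    simp only at h3
    rw [h1, h2, ← hTT, Nat.add_sub_cancel_left, ← sub_eq_zero, ← Finset.sum_sub_distrib] at h3
    simpa only [sub_mul] using h3

/-- Regularity of the vanishing counts passes from a code to its dual. -/
theorem MacWilliams.cardDetermined_transfer {q : ℕ} {P Q : Finset (Fin n → F)}
    (hPQ : MacWilliams q P Q) (hQ0 : (0 : Fin n → F) ∈ Q) {t : ℕ}
    (hQ : ∀ j, CardDetermined t (vanishWtCount Q j)) (j : ℕ) :
    CardDetermined t (vanishWtCount P j) := by
  have hQpos : (Q.card : ℤ) ≠ 0 := by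
    exact_mod_cast (Finset.card_pos.2 ⟨0, hQ0⟩).ne'
  refine cardDetermined_vanishWtCount_of_sum (fun v hv => ?_) j
  have hG : CardDetermined t fun T : Finset (Fin n) =>
      ∑ U with T ⊆ U, if U.card = n - v then vanishCount Q U else 0 := by
    simpa only [← Finset.sum_filter, Finset.filter_filter] using
      cardDetermined_sum_supersets hQ (n - v)
  have hrel : ∀ T : Finset (Fin n),
      (∑ V with T ⊆ V ∧ V.card = v, vanishCount P V) * Q.card =
        (∑ U with Disjoint T U, if U.card = n - v then vanishCount Q U else 0) *
          (q : ℤ) ^ (n - v) := by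
    intro T
    rw [← Finset.sum_filter, Finset.filter_filter, Finset.sum_mul, Finset.sum_mul]
    refine Finset.sum_nbij' (fun V => Vᶜ) (fun U => Uᶜ) ?_ ?_ (by simp) (by simp) ?_
    · intro V hV
      have hV' := (Finset.mem_filter.1 hV).2
      refine Finset.mem_filter.2 ⟨Finset.mem_univ _, disjoint_compl_right_iff.2 hV'.1, ?_⟩
      rw [Finset.card_compl, Fintype.card_fin, hV'.2]
    · intro U hU
      have hU' := (Finset.mem_filter.1 hU).2
      refine Finset.mem_filter.2
        ⟨Finset.mem_univ _, Finset.subset_compl_iff_disjoint_right.2 hU'.1, ?_⟩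
      rw [Finset.card_compl, Fintype.card_fin, hU'.2]
      omega
    · intro V hV
      rw [hPQ V, (Finset.mem_filter.1 hV).2.2]
  intro T T' hTT hT
  refine mul_right_cancel₀ hQpos ?_
  simp only
  rw [hrel T, hrel T']
  congr 1
  exact hG.sum_disjoint T T' hTT hT

theorem cardDetermined_card_subset_supp {P : Finset (Fin n → F)} {t j : ℕ}
    (hP : CardDetermined t (vanishWtCount P j)) :
    CardDetermined t fun T => ((P.filter fun x => wt x = j ∧ T ⊆ supp x).card : ℤ) := by
  have hfiber : ∀ (p : Finset (Fin n) → Prop) [DecidablePred p],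
      ((P.filter fun x => wt x = j ∧ p (supp x)ᶜ).card : ℤ) =
        ∑ U with p U, ((P.filter fun x => wt x = j ∧ (supp x)ᶜ = U).card : ℤ) := by
    intro p _
    rw [Finset.card_eq_sum_card_fiberwise (f := fun x => (supp x)ᶜ) (t := univ.filter p)]
    · push_cast
      refine Finset.sum_congr rfl fun U hU => ?_
      rw [Finset.filter_filter]
      congr 2
      ext x
      simp only [Finset.mem_filter, Finset.mem_univ, true_and] at hU ⊢
      constructor
      · tauto
      · rintro ⟨hx, h1, rfl⟩
        exact ⟨hx, ⟨h1, hU⟩, rfl⟩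
    · intro x hx
      simpa using (Finset.mem_filter.1 hx).2.2
  have h1 : CardDetermined t fun T : Finset (Fin n) =>
      ∑ U with T ⊆ U, ((P.filter fun x => wt x = j ∧ (supp x)ᶜ = U).card : ℤ) := by
    have : ∀ T : Finset (Fin n), vanishWtCount P j T =
        ∑ U with T ⊆ U, ((P.filter fun x => wt x = j ∧ (supp x)ᶜ = U).card : ℤ) := by
      intro T
      rw [← hfiber (T ⊆ ·), vanishWtCount]
      simp only [Finset.subset_compl_iff_disjoint_left]
    simpa only [← this] using hP
  have h2 : ∀ T : Finset (Fin n), ((P.filter fun x => wt x = j ∧ T ⊆ supp x).card : ℤ) =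
      ∑ U with Disjoint T U, ((P.filter fun x => wt x = j ∧ (supp x)ᶜ = U).card : ℤ) := by
    intro T
    rw [← hfiber (Disjoint T ·)]
    simp only [disjoint_compl_right_iff]
  simpa only [h2] using h1.sum_disjoint

end Words

section Duality

variable {F : Type} [Field F] {n : ℕ}

/-- The words supported on `S`. -/
def supportedOn (F : Type) [Field F] {n : ℕ} (S : Finset (Fin n)) : Submodule F (Fin n → F) where
  carrier := {x | ∀ i ∉ S, x i = 0}
  add_mem' hx hy i hi := by simp [hx i hi, hy i hi]
  zero_mem' _ _ := rfl
  smul_mem' c x hx i hi := by simp [hx i hi]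

theorem mem_supportedOn {S : Finset (Fin n)} {x : Fin n → F} :
    x ∈ supportedOn F S ↔ ∀ i ∉ S, x i = 0 := Iff.rfl

theorem mem_supportedOn_iff_disjoint {S : Finset (Fin n)} {x : Fin n → F} :
    x ∈ supportedOn F S ↔ Disjoint (supp x) Sᶜ := by
  rw [mem_supportedOn, Finset.disjoint_right]
  simp [supp]

theorem finrank_supportedOn (S : Finset (Fin n)) :
    Module.finrank F (supportedOn F S) = S.card := by
  let e : supportedOn F S ≃ₗ[F] (S → F) :=
    { toFun := fun x i => x.1 i
      map_add' := fun _ _ => rfl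
      map_smul' := fun _ _ => rfl
      invFun := fun y => ⟨fun i => if h : i ∈ S then y ⟨i, h⟩ else 0,
        fun i hi => by simp [hi]⟩
      left_inv := fun x => by
        ext i
        by_cases h : i ∈ S
        · simp [h]
        · simp [h, x.2 i h]
      right_inv := fun y => by
        ext i
        simp }
  rw [e.finrank_eq]
  simp

/-- The dual of a linear code for the dot product. -/
def dualCode (C : Submodule F (Fin n → F)) : Submodule F (Fin n → F) :=
  LinearMap.BilinForm.orthogonal (dotProductBilin F F) C

theorem mem_dualCode {C : Submodule F (Fin n → F)} {y : Fin n → F} :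
    y ∈ dualCode C ↔ ∀ x ∈ C, ∑ ℓ, x ℓ * y ℓ = 0 := Iff.rfl

theorem dotProductBilin_isRefl :
    LinearMap.BilinForm.IsRefl (dotProductBilin F F : LinearMap.BilinForm F (Fin n → F)) := by
  intro x y h
  change y ⬝ᵥ x = 0
  rw [dotProduct_comm]
  exact h

theorem dotProductBilin_nondegenerate :
    LinearMap.BilinForm.Nondegenerate
      (dotProductBilin F F : LinearMap.BilinForm F (Fin n → F)) := by
  refine (LinearMap.IsRefl.nondegenerate_iff_separatingLeft
    (B := (dotProductBilin F F : LinearMap.BilinForm F (Fin n → F)))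
    dotProductBilin_isRefl).2 fun x hx => ?_
  exact dotProduct_eq_zero x hx

theorem finrank_dualCode (C : Submodule F (Fin n → F)) :
    Module.finrank F (dualCode C) = n - Module.finrank F C := by
  rw [dualCode, LinearMap.BilinForm.finrank_orthogonal dotProductBilin_nondegenerate]
  simp

theorem dualCode_dualCode (C : Submodule F (Fin n → F)) : dualCode (dualCode C) = C :=
  LinearMap.BilinForm.orthogonal_orthogonal dotProductBilin_nondegenerate
    dotProductBilin_isRefl C

theorem dualCode_sup_supportedOn (C : Submodule F (Fin n → F)) (S : Finset (Fin n)) :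
    dualCode (C ⊔ supportedOn F S) = dualCode C ⊓ supportedOn F Sᶜ := by
  ext y
  rw [Submodule.mem_inf, mem_supportedOn, mem_dualCode, mem_dualCode]
  constructor
  · intro h
    refine ⟨fun x hx => h x (Submodule.mem_sup_left hx), fun i hi => ?_⟩
    have hi' : i ∈ S := by simpa using hi
    have hs : Pi.single i (1 : F) ∈ supportedOn F S := fun k hk =>
      Pi.single_eq_of_ne (fun hki : k = i => hk (hki ▸ hi')) _
    simpa [Pi.single_apply] using h _ (Submodule.mem_sup_right hs)
  · rintro ⟨h1, h2⟩ x hx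
    obtain ⟨u, hu, v, hv, rfl⟩ := Submodule.mem_sup.1 hx
    have hv0 : ∑ ℓ, v ℓ * y ℓ = 0 := Finset.sum_eq_zero fun ℓ _ => by
      by_cases hl : ℓ ∈ S
      · rw [h2 ℓ (by simpa using hl), mul_zero]
      · rw [hv ℓ hl, zero_mul]
    simp_rw [Pi.add_apply, add_mul]
    rw [Finset.sum_add_distrib, h1 u hu, hv0, add_zero]

theorem finrank_inf_supportedOn (C : Submodule F (Fin n → F)) (S : Finset (Fin n)) :
    Module.finrank F (C ⊓ supportedOn F Sᶜ : Submodule F (Fin n → F)) +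
        Module.finrank F (dualCode C) =
      Module.finrank F (dualCode C ⊓ supportedOn F S : Submodule F (Fin n → F)) +
        (n - S.card) := by
  have h1 := finrank_dualCode (dualCode C ⊔ supportedOn F S)
  rw [dualCode_sup_supportedOn, dualCode_dualCode] at h1
  have h2 := Submodule.finrank_sup_add_finrank_inf_eq (dualCode C) (supportedOn F S)
  rw [finrank_supportedOn] at h2
  have h3 := Submodule.finrank_le (dualCode C ⊔ supportedOn F S)
  have h4 : S.card ≤ n := by simpa using Finset.card_le_univ S
  simp only [Module.finrank_fintype_fun_eq_card, Fintype.card_fin] at h3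
  omega

variable [Fintype F]

theorem card_filter_mem (C : Submodule F (Fin n → F)) :
    (univ.filter fun x => x ∈ C).card = Fintype.card F ^ Module.finrank F C := by
  rw [← Module.card_eq_pow_finrank (K := F) (V := C), Fintype.card_subtype]

theorem vanishCount_filter_mem (C : Submodule F (Fin n → F)) (S : Finset (Fin n)) :
    vanishCount (univ.filter fun x => x ∈ C) S =
      (Fintype.card F : ℤ) ^
        Module.finrank F (C ⊓ supportedOn F Sᶜ : Submodule F (Fin n → F)) := by
  rw [vanishCount, Finset.filter_filter, ← Nat.cast_pow, ← card_filter_mem]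
  simp only [Submodule.mem_inf, mem_supportedOn_iff_disjoint, compl_compl]

theorem macWilliams_dualCode (C : Submodule F (Fin n → F)) :
    MacWilliams (Fintype.card F) (univ.filter fun x => x ∈ C)
      (univ.filter fun x => x ∈ dualCode C) := by
  intro S
  rw [vanishCount_filter_mem, vanishCount_filter_mem, card_filter_mem, Nat.cast_pow, ← pow_add,
    ← pow_add, compl_compl, finrank_inf_supportedOn]

/-- A code with few weights compared with the minimum weight of its dual is regular. -/
theorem cardDetermined_vanishWtCount_of_dualCode (C : Submodule F (Fin n → F)) {t d : ℕ}
    (hd : ∀ y ∈ dualCode C, y ≠ 0 → d ≤ wt y)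
    (hJ : ((Finset.Icc 1 (n - t)).filter fun w => ∃ x ∈ C, wt x = w).card + t ≤ d) (j : ℕ) :
    CardDetermined t (vanishWtCount (univ.filter fun x => x ∈ C) j) := by
  refine (macWilliams_dualCode C).cardDetermined_vanishWtCount ?_ ?_ (d := d) ?_ ?_ j
  · simp
  · simp
  · simpa using hd
  · simpa using hJ

end Duality

/-- **Assmus–Mattson theorem** (Assmus and Mattson, 1969). -/
theorem assmus_mattson {F : Type} [Field F] [Fintype F] {n : ℕ}
    (C : Submodule F (Fin n → F)) (hC_bot : C ≠ ⊥) (hC_top : C ≠ ⊤)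
    (Cperp : Set (Fin n → F))
    (hCperp : Cperp = {y | ∀ x ∈ C, ∑ ℓ, x ℓ * y ℓ = 0})
    (δ δs : ℕ)
    (hδ : δ = sInf {w | ∃ x ∈ C, x ≠ 0 ∧ wt x = w})
    (hδs : δs = sInf {w | ∃ y ∈ Cperp, y ≠ 0 ∧ wt y = w})
    (t : ℕ) (ht1 : 1 ≤ t) (htn : t ≤ n)
    (hyp :
      ((((Finset.Icc 1 (n - t)).filter fun w => ∃ y ∈ Cperp, wt y = w).card : ℤ)
          ≤ (δ : ℤ) - (t : ℤ)) ∨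
      ((((Finset.Icc 1 (n - t)).filter fun w => ∃ x ∈ C, wt x = w).card : ℤ)
          ≤ (δs : ℤ) - (t : ℤ))) :
    ∀ w : ℕ, w ≤ n →
      ∃ lam : ℕ, ∀ T : Finset (Fin n), T.card = t →
        (univ.filter fun x : Fin n → F => x ∈ C ∧ wt x = w ∧ T ⊆ supp x).card = lam := by
  intro w _
  have hmem : ∀ y, y ∈ Cperp ↔ y ∈ dualCode C := by
    intro y
    rw [hCperp, mem_dualCode, Set.mem_ofPred_eq]
  have hdC : ∀ x ∈ C, x ≠ 0 → δ ≤ wt x := fun x hx h0 =>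
    hδ.trans_le (Nat.sInf_le ⟨x, hx, h0, rfl⟩)
  have hdD : ∀ y ∈ dualCode C, y ≠ 0 → δs ≤ wt y := fun y hy h0 =>
    hδs.trans_le (Nat.sInf_le ⟨y, (hmem y).2 hy, h0, rfl⟩)
  have hC : ∀ j, CardDetermined t (vanishWtCount (univ.filter fun x => x ∈ C) j) := by
    rcases hyp with hyp | hyp
    · simp only [hmem] at hyp
      refine (macWilliams_dualCode C).cardDetermined_transfer (by simp)
        (cardDetermined_vanishWtCount_of_dualCode (dualCode C) (d := δ) ?_ (by omega))
      rwa [dualCode_dualCode]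
    · exact cardDetermined_vanishWtCount_of_dualCode C hdD (by omega)
  obtain ⟨c, hc⟩ := (cardDetermined_card_subset_supp (hC w)).exists_eq
  refine ⟨(c t).toNat, fun T hT => ?_⟩
  have h := hc T hT.le
  rw [Finset.filter_filter, hT] at h
  rw [← h, Int.toNat_natCast]
end
end

section
/- Assmus–Mattson theorem for codes over commutative association schemes: Let (X, {R₀,…,R_s}) be a commutative association scheme with s ≥ 1 classes, fix x₀ ∈ X and n ≥ 2, and let C ⊆ X^n with 1 < |C| < |X|^n. For 1 ≤ r ≤ n let S_r = {α ∈ ℕ^s : r ≤ |α| ≤ n−r and (X^n)_α ∩ C ≠ ∅}, regarded as a finite set of points of ℝ^s, and let δ* = min{i : 1 ≤ i ≤ n, B_i ≠ 0}. Suppose an integer t with 1 ≤ t ≤ n satisfies μ(S_r) < δ* − r for all 1 ≤ r ≤ t. Then for every α ∈ ℕ^s with |α| ≤ n, the multiset {supp(x) : x ∈ (X^n)_α ∩ C} is a t-design with blocks of size |α|. -/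
open Finset
open scoped Classical

noncomputable section

/-- The 0-1 adjacency matrix of a relation on `X`. -/
def adjMat {X : Type} [Fintype X] [DecidableEq X] (R : Set (X × X)) : Matrix X X ℂ :=
  fun x y => if (x, y) ∈ R then 1 else 0

/-- A commutative association scheme with `s` classes on a finite set `X`. -/
structure CommAssocScheme (X : Type) [Fintype X] [DecidableEq X] (s : ℕ) where
  R : Fin (s + 1) → Set (X × X)
  rel_nonempty : ∀ i, (R i).Nonempty
  rel_disjoint : ∀ i j, i ≠ j → R i ∩ R j = ∅
  rel_cover : ∀ p : X × X, ∃ i, p ∈ R i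
  rel_diag : R 0 = {p : X × X | p.1 = p.2}
  transpose_closed : ∀ i, ∃ j, {p : X × X | (p.2, p.1) ∈ R i} = R j
  adj_comm : ∀ i j, adjMat (R i) * adjMat (R j) = adjMat (R j) * adjMat (R i)
  adj_span : ∀ i j, adjMat (R i) * adjMat (R j) ∈
    Submodule.span ℂ (Set.range fun k => adjMat (R k))

/-- The composition `c(x,y) ∈ ℕ^s` of two words `x, y ∈ X^n`. -/
def comp {X : Type} [Fintype X] [DecidableEq X] {s : ℕ} (A : CommAssocScheme X s)
    {n : ℕ} (x y : Fin n → X) : Fin s → ℕ :=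
  fun i => (univ.filter fun ℓ => (x ℓ, y ℓ) ∈ A.R i.succ).card

/-- The Krawtchouk number `K_i(j)` for the Hamming scheme `H(n,q)`. -/
def kraw (q n i j : ℕ) : ℝ :=
  ∑ h ∈ Finset.range (i + 1),
    (-1 : ℝ) ^ h * ((q : ℝ) - 1) ^ (i - h) * (j.choose h : ℝ) * ((n - j).choose (i - h) : ℝ)

/-- `L` is an interpolation space with respect to `S ⊆ ℝ^s`. -/
def IsInterpSpace {s : ℕ} (S : Set (Fin s → ℝ)) (L : Submodule ℝ (MvPolynomial (Fin s) ℝ)) :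
    Prop :=
  ∀ f : MvPolynomial (Fin s) ℝ, ∃! g : MvPolynomial (Fin s) ℝ,
    g ∈ L ∧ ∀ z ∈ S, MvPolynomial.eval z g = MvPolynomial.eval z f

/-- `L` is a minimal degree interpolation space with respect to `S ⊆ ℝ^s`. -/
def IsMinDegInterpSpace {s : ℕ} (S : Set (Fin s → ℝ))
    (L : Submodule ℝ (MvPolynomial (Fin s) ℝ)) : Prop :=
  IsInterpSpace S L ∧
    ∀ f g : MvPolynomial (Fin s) ℝ, g ∈ L →
      (∀ z ∈ S, MvPolynomial.eval z g = MvPolynomial.eval z f) →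
      g.totalDegree ≤ f.totalDegree

/-- The maximal total degree occurring in a space of polynomials. -/
def degSup {s : ℕ} (L : Submodule ℝ (MvPolynomial (Fin s) ℝ)) : ℕ :=
  sSup (MvPolynomial.totalDegree '' (L : Set (MvPolynomial (Fin s) ℝ)))

/-- `μ(S)`: the maximal degree of a minimal degree interpolation space with respect to `S`. -/
def mu {s : ℕ} (S : Set (Fin s → ℝ)) : ℕ :=
  sSup (degSup '' {L | IsMinDegInterpSpace S L})

/-! ### Minimal degree interpolation -/

/-- Evaluation is injective on `L`, and every member of `L` has least degree among the polynomials
with the same values on `S`. -/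
def HasLeastDegrees {s : ℕ} (S : Set (Fin s → ℝ)) (L : Submodule ℝ (MvPolynomial (Fin s) ℝ)) : Prop :=
  ∀ g ∈ L, ((∀ z ∈ S, MvPolynomial.eval z g = 0) → g = 0) ∧
    ∀ f : MvPolynomial (Fin s) ℝ, (∀ z ∈ S, MvPolynomial.eval z g = MvPolynomial.eval z f) →
      g.totalDegree ≤ f.totalDegree

theorem exists_maximal_hasLeastDegrees {s : ℕ} (S : Set (Fin s → ℝ)) :
    ∃ L, Maximal (HasLeastDegrees S) L := by
  obtain ⟨L, -, hL⟩ := zorn_le_nonempty₀ {L | HasLeastDegrees S L} (fun c hc hchain y hy => by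
    refine ⟨sSup c, fun g hg => ?_, fun z hz => le_sSup hz⟩
    obtain ⟨L, hL, hgL⟩ := (Submodule.mem_sSup_of_directed ⟨y, hy⟩ hchain.directedOn).1 hg
    exact hc hL g hgL) ⊥ (by
      intro g hg
      rw [Submodule.mem_bot] at hg
      subst hg
      simp)
  exact ⟨L, hL⟩

theorem HasLeastDegrees.sup_span_singleton {s : ℕ} {S : Set (Fin s → ℝ)}
    {L : Submodule ℝ (MvPolynomial (Fin s) ℝ)} (hL : HasLeastDegrees S L)
    {h : MvPolynomial (Fin s) ℝ}
    (hh : ¬ ∃ g ∈ L, ∀ z ∈ S, MvPolynomial.eval z g = MvPolynomial.eval z h)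
    (hmin : ∀ f : MvPolynomial (Fin s) ℝ,
      (¬ ∃ g ∈ L, ∀ z ∈ S, MvPolynomial.eval z g = MvPolynomial.eval z f) →
      h.totalDegree ≤ f.totalDegree) :
    HasLeastDegrees S (L ⊔ Submodule.span ℝ {h}) := by
  intro g hg
  obtain ⟨l, hl, y, hy, rfl⟩ := Submodule.mem_sup.1 hg
  obtain ⟨c, rfl⟩ := Submodule.mem_span_singleton.1 hy
  by_cases hc : c = 0
  · subst hc
    simpa using hL l hl
  constructor
  · intro h0
    refine (hh ⟨(-c⁻¹) • l, L.smul_mem _ hl, fun z hz => ?_⟩).elim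
    have := h0 z hz
    simp only [map_add, MvPolynomial.smul_eval] at this ⊢
    field_simp
    linarith
  · intro f hf
    have hdh : h.totalDegree ≤ f.totalDegree := by
      refine hmin f ?_
      rintro ⟨g, hg, hgf⟩
      refine hh ⟨c⁻¹ • (g - l), L.smul_mem _ (L.sub_mem hg hl), fun z hz => ?_⟩
      have h1 := hf z hz
      have h2 := hgf z hz
      simp only [map_add, map_sub, MvPolynomial.smul_eval] at h1 ⊢
      field_simp
      linarith
    have hch : (c • h).totalDegree ≤ f.totalDegree :=
      (MvPolynomial.totalDegree_smul_le c h).trans hdh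
    have hdl : l.totalDegree ≤ f.totalDegree := by
      refine ((hL l hl).2 (f - c • h) fun z hz => ?_).trans
        ((MvPolynomial.totalDegree_sub _ _).trans (max_le le_rfl hch))
      have h1 := hf z hz
      simp only [map_add, map_sub] at h1 ⊢
      linarith
    exact (MvPolynomial.totalDegree_add _ _).trans (max_le hdl hch)

theorem exists_isMinDegInterpSpace {s : ℕ} (S : Set (Fin s → ℝ)) :
    ∃ L, IsMinDegInterpSpace S L := by
  obtain ⟨L, hL⟩ := exists_maximal_hasLeastDegrees S
  refine ⟨L, fun f => ?_, fun f g hg => (hL.prop g hg).2 f⟩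
  have hex : ∀ f : MvPolynomial (Fin s) ℝ,
      ∃ g ∈ L, ∀ z ∈ S, MvPolynomial.eval z g = MvPolynomial.eval z f := by
    by_contra! hcon
    let P : Set (MvPolynomial (Fin s) ℝ) :=
      {f | ¬ ∃ g ∈ L, ∀ z ∈ S, MvPolynomial.eval z g = MvPolynomial.eval z f}
    have hP : P.Nonempty := by
      obtain ⟨f, hf⟩ := hcon
      exact ⟨f, by simpa [P] using hf⟩
    let h := Function.argminOn MvPolynomial.totalDegree P hP
    have hmem : h ∈ P := Function.argminOn_mem _ _ _
    have hle := hL.le_of_ge (hL.prop.sup_span_singleton hmem fun f hf =>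
      Function.argminOn_le MvPolynomial.totalDegree P (a := f) hf) le_sup_left
    exact hmem ⟨h, hle (Submodule.mem_sup_right (Submodule.mem_span_singleton_self h)),
      fun _ _ => rfl⟩
  obtain ⟨g, hg, hgf⟩ := hex f
  refine ⟨g, ⟨hg, hgf⟩, fun g' ⟨hg', hgf'⟩ => ?_⟩
  refine sub_eq_zero.1 ((hL.prop _ (L.sub_mem hg' hg)).1 fun z hz => ?_)
  rw [map_sub, hgf z hz, hgf' z hz, sub_self]

theorem exists_eval_indicator {s : ℕ} (S : Finset (Fin s → ℝ)) (z : Fin s → ℝ) :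
    ∃ p : MvPolynomial (Fin s) ℝ, ∀ w ∈ S, MvPolynomial.eval w p = if w = z then 1 else 0 := by
  have hsep : ∀ w : Fin s → ℝ, ∃ p : MvPolynomial (Fin s) ℝ, w ≠ z →
      MvPolynomial.eval z p = 1 ∧ MvPolynomial.eval w p = 0 := by
    intro w
    by_cases hw : w = z
    · exact ⟨0, fun h => (h hw).elim⟩
    obtain ⟨i, hi⟩ := Function.ne_iff.1 hw
    refine ⟨MvPolynomial.C (z i - w i)⁻¹ * (MvPolynomial.X i - MvPolynomial.C (w i)),
      fun _ => ⟨?_, ?_⟩⟩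
    · simpa using inv_mul_cancel₀ (sub_ne_zero.2 hi.symm)
    · simp
  choose p hp using hsep
  refine ⟨∏ w ∈ S.erase z, p w, fun w hw => ?_⟩
  rw [MvPolynomial.eval_prod]
  split_ifs with h
  · subst h
    exact prod_eq_one fun v hv => (hp v (ne_of_mem_erase hv)).1
  · exact prod_eq_zero (mem_erase.2 ⟨h, hw⟩) (hp w h).2

theorem exists_degree_bound {s : ℕ} (S : Finset (Fin s → ℝ)) :
    ∃ N : ℕ, ∀ f : MvPolynomial (Fin s) ℝ, ∃ g : MvPolynomial (Fin s) ℝ,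
      g.totalDegree ≤ N ∧ ∀ z ∈ S, MvPolynomial.eval z f = MvPolynomial.eval z g := by
  choose p hp using exists_eval_indicator S
  refine ⟨S.sup fun z => (p z).totalDegree, fun f =>
    ⟨∑ z ∈ S, MvPolynomial.eval z f • p z, ?_, fun z hz => ?_⟩⟩
  · exact MvPolynomial.totalDegree_finsetSum_le fun z hz =>
      (MvPolynomial.totalDegree_smul_le _ _).trans (le_sup (f := fun z => (p z).totalDegree) hz)
  · rw [map_sum, sum_congr rfl fun w _ => by rw [MvPolynomial.smul_eval, hp w z hz]]
    simp [hz]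

/-- The indicator of a point of a finite set `S` is interpolated in degree at most `μ(S)`. -/
theorem exists_eval_indicator_totalDegree_le_mu {s : ℕ} (S : Finset (Fin s → ℝ))
    (z : Fin s → ℝ) :
    ∃ p : MvPolynomial (Fin s) ℝ, p.totalDegree ≤ mu (S : Set (Fin s → ℝ)) ∧
      ∀ w ∈ S, MvPolynomial.eval w p = if w = z then 1 else 0 := by
  obtain ⟨N, hN⟩ := exists_degree_bound S
  have hbound : ∀ L, IsMinDegInterpSpace (S : Set (Fin s → ℝ)) L →
      ∀ g ∈ L, g.totalDegree ≤ N := by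
    intro L hL g hg
    obtain ⟨f, hf, hfg⟩ := hN g
    exact (hL.2 f g hg hfg).trans hf
  obtain ⟨L, hL⟩ := exists_isMinDegInterpSpace (S : Set (Fin s → ℝ))
  obtain ⟨p, hp⟩ := exists_eval_indicator S z
  obtain ⟨g, ⟨hg, hgp⟩, -⟩ := hL.1 p
  refine ⟨g, ?_, fun w hw => (hgp w hw).trans (hp w hw)⟩
  have h1 : g.totalDegree ≤ degSup L :=
    le_csSup ⟨N, by rintro _ ⟨f, hf, rfl⟩; exact hbound L hL f hf⟩ ⟨g, hg, rfl⟩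
  have h2 : degSup L ≤ mu (S : Set (Fin s → ℝ)) := by
    refine le_csSup ⟨N, ?_⟩ ⟨L, hL, rfl⟩
    rintro _ ⟨L', hL', rfl⟩
    refine csSup_le' ?_
    rintro _ ⟨f, hf, rfl⟩
    exact hbound L' hL' f hf
  exact h1.trans h2

/-! ### Functions of few coordinates -/

/-- The span of the functions on `X^n` that depend on at most `d` coordinates. -/
def juntaSpan (X : Type) (n d : ℕ) : Submodule ℝ ((Fin n → X) → ℝ) :=
  Submodule.span ℝ {g | ∃ U : Finset (Fin n), U.card ≤ d ∧ DependsOn g (U : Set (Fin n))}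

theorem mem_juntaSpan_of_dependsOn {X : Type} {n d : ℕ} {g : (Fin n → X) → ℝ}
    {U : Finset (Fin n)} (hU : U.card ≤ d) (hg : DependsOn g (U : Set (Fin n))) :
    g ∈ juntaSpan X n d :=
  Submodule.subset_span ⟨U, hU, hg⟩

theorem juntaSpan_mono {X : Type} {n d e : ℕ} (h : d ≤ e) :
    juntaSpan X n d ≤ juntaSpan X n e :=
  Submodule.span_mono fun _ ⟨U, hU, hg⟩ => ⟨U, hU.trans h, hg⟩

theorem mul_mem_juntaSpan {X : Type} {n d e : ℕ} {f g : (Fin n → X) → ℝ}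
    (hf : f ∈ juntaSpan X n d) (hg : g ∈ juntaSpan X n e) : f * g ∈ juntaSpan X n (d + e) := by
  have := Submodule.mul_mem_mul hf hg
  rw [juntaSpan, juntaSpan, Submodule.span_mul_span] at this
  refine Submodule.span_mono ?_ this
  rintro _ ⟨f, ⟨U, hU, hf⟩, g, ⟨V, hV, hg⟩, rfl⟩
  refine ⟨U ∪ V, (card_union_le _ _).trans (add_le_add hU hV), fun x y hxy => ?_⟩
  change f x * g x = f y * g y
  rw [hf fun i hi => hxy i (by simp_all), hg fun i hi => hxy i (by simp_all)]

theorem const_mem_juntaSpan {X : Type} {n d : ℕ} (c : ℝ) :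
    (fun _ => c) ∈ juntaSpan X n d :=
  mem_juntaSpan_of_dependsOn (U := ∅) (by simp) fun _ _ _ => rfl

theorem pow_mem_juntaSpan {X : Type} {n : ℕ} {f : (Fin n → X) → ℝ} (hf : f ∈ juntaSpan X n 1)
    (k : ℕ) : f ^ k ∈ juntaSpan X n k := by
  induction k with
  | zero => exact const_mem_juntaSpan 1
  | succ k ih => exact pow_succ f k ▸ mul_mem_juntaSpan ih hf

theorem prod_pow_mem_juntaSpan {X : Type} {n : ℕ} {ι : Type*} (T : Finset ι)
    {f : ι → (Fin n → X) → ℝ} (hf : ∀ i, f i ∈ juntaSpan X n 1) (k : ι → ℕ) :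
    ∏ i ∈ T, f i ^ k i ∈ juntaSpan X n (∑ i ∈ T, k i) := by
  induction T using Finset.induction_on with
  | empty => exact const_mem_juntaSpan 1
  | insert i T hi ih =>
    rw [prod_insert hi, sum_insert hi]
    exact mul_mem_juntaSpan (pow_mem_juntaSpan (hf i) _) ih

theorem eval_mem_juntaSpan {X : Type} {n s : ℕ} {f : Fin s → (Fin n → X) → ℝ}
    (hf : ∀ i, f i ∈ juntaSpan X n 1) (p : MvPolynomial (Fin s) ℝ) :
    (fun x => MvPolynomial.eval (fun i => f i x) p) ∈ juntaSpan X n p.totalDegree := by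
  have hp : (fun x => MvPolynomial.eval (fun i => f i x) p) =
      ∑ m ∈ p.support, p.coeff m • ∏ i, f i ^ m i := by
    ext x
    simp [MvPolynomial.eval_eq', Finset.sum_apply, Finset.prod_apply]
  rw [hp]
  refine Submodule.sum_mem _ fun m hm => Submodule.smul_mem _ _ ?_
  refine juntaSpan_mono ?_ (prod_pow_mem_juntaSpan univ hf m)
  simpa [Finsupp.sum_fintype] using MvPolynomial.le_totalDegree hm

/-! ### Orthogonal arrays -/

/-- The entries of the matrix `qI - J`, where `q = |X|`. -/
def centered {X : Type} [Fintype X] (a b : X) : ℝ :=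
  (Fintype.card X : ℝ) * (if a = b then 1 else 0) - 1

theorem sum_centered {X : Type} [Fintype X] (a : X) : ∑ b : X, centered a b = 0 := by
  simp [centered, sum_sub_distrib]

theorem sum_centered_mul_centered {X : Type} [Fintype X] (a b : X) :
    ∑ z : X, centered z a * centered z b = Fintype.card X * centered a b := by
  have h : ∀ z : X, centered z a * centered z b =
      (Fintype.card X : ℝ) ^ 2 * ((if z = a then 1 else 0) * (if z = b then 1 else 0))
        - Fintype.card X * (if z = a then 1 else 0) - Fintype.card X * (if z = b then 1 else 0)
        + 1 := by
    intro z
    simp only [centered]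
    ring
  simp only [h, sum_add_distrib, sum_sub_distrib, ← mul_sum, ite_mul, one_mul, zero_mul,
    sum_ite_eq', mem_univ, if_true, sum_const, card_univ, nsmul_eq_mul]
  rw [centered]
  ring

theorem sum_powersetCard_prod_centered {X : Type} [Fintype X] [DecidableEq X] {n : ℕ}
    (i : ℕ) (x y : Fin n → X) :
    ∑ U ∈ powersetCard i (univ : Finset (Fin n)), ∏ ℓ ∈ U, centered (x ℓ) (y ℓ) =
      kraw (Fintype.card X) n i (hammingDist x y) := by
  set q := Fintype.card X
  have hcoeff : ∀ (a : ℝ) (j k : ℕ),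
      ((1 + Polynomial.C a * Polynomial.X) ^ j).coeff k = a ^ k * (j.choose k : ℝ) := by
    intro a j k
    have : (1 + Polynomial.C a * Polynomial.X : Polynomial ℝ) ^ j =
        ((1 + Polynomial.X) ^ j : Polynomial ℝ).comp (Polynomial.C a * Polynomial.X) := by simp
    rw [this, Polynomial.comp_C_mul_X_coeff, Polynomial.coeff_one_add_X_pow, mul_comm]
  have hcard : (univ.filter fun ℓ => ¬ x ℓ ≠ y ℓ).card = n - hammingDist x y := by
    have h := card_filter_add_card_filter_not (s := (univ : Finset (Fin n)))
      (fun ℓ => x ℓ ≠ y ℓ)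
    rw [card_univ, Fintype.card_fin] at h
    have h' : hammingDist x y = (univ.filter fun ℓ => x ℓ ≠ y ℓ).card := by
      unfold hammingDist; congr
    omega
  have hcard' : (univ.filter fun ℓ => x ℓ ≠ y ℓ).card = hammingDist x y := by
    unfold hammingDist; congr
  have hprod : ∏ ℓ, (1 + Polynomial.C (centered (x ℓ) (y ℓ)) * Polynomial.X) =
      (1 + Polynomial.C (-1 : ℝ) * Polynomial.X) ^ hammingDist x y *
        (1 + Polynomial.C ((q : ℝ) - 1) * Polynomial.X) ^ (n - hammingDist x y) := by
    rw [← prod_filter_mul_prod_filter_not univ (fun ℓ => x ℓ ≠ y ℓ)]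
    congr 1
    · rw [prod_congr rfl fun ℓ hℓ => by rw [centered, if_neg (mem_filter.1 hℓ).2],
        prod_const, hcard']
      simp
    · rw [prod_congr rfl fun ℓ hℓ => by rw [centered, if_pos (not_not.1 (mem_filter.1 hℓ).2)],
        prod_const, hcard]
      simp [q]
  have h := congrArg (fun p => Polynomial.coeff p i) hprod
  rw [prod_one_add, Polynomial.finsetSum_coeff, Polynomial.coeff_mul,
    Nat.sum_antidiagonal_eq_sum_range_succ_mk] at h
  rw [powersetCard_eq_filter, sum_filter, kraw]
  refine Eq.trans (sum_congr rfl fun U _ => ?_) (h.trans (sum_congr rfl fun k _ => ?_))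
  · rw [prod_mul_distrib, prod_const, ← map_prod, Polynomial.coeff_C_mul_X_pow]
    simp only [eq_comm]
  · rw [hcoeff, hcoeff]
    ring

theorem sum_prod_centered_sq {X : Type} [Fintype X] {n : ℕ} (C : Finset (Fin n → X))
    (U : Finset (Fin n)) :
    ∑ z : Fin n → X, (∑ x ∈ C, ∏ ℓ ∈ U, centered (z ℓ) (x ℓ)) ^ 2 =
      (Fintype.card X : ℝ) ^ n * ∑ x ∈ C, ∑ y ∈ C, ∏ ℓ ∈ U, centered (x ℓ) (y ℓ) := by
  have key : ∀ x y : Fin n → X,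
      ∑ z : Fin n → X, (∏ ℓ ∈ U, centered (z ℓ) (x ℓ)) * ∏ ℓ ∈ U, centered (z ℓ) (y ℓ) =
        (Fintype.card X : ℝ) ^ n * ∏ ℓ ∈ U, centered (x ℓ) (y ℓ) := by
    intro x y
    calc _ = ∑ z : Fin n → X, ∏ ℓ,
          (if ℓ ∈ U then centered (z ℓ) (x ℓ) * centered (z ℓ) (y ℓ) else 1) := by
          refine sum_congr rfl fun z _ => ?_
          rw [← prod_mul_distrib, prod_ite_mem, univ_inter]
      _ = ∏ ℓ, ∑ a : X, (if ℓ ∈ U then centered a (x ℓ) * centered a (y ℓ) else 1) := by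
          rw [Finset.prod_univ_sum, Fintype.piFinset_univ]
      _ = ∏ ℓ, (Fintype.card X * if ℓ ∈ U then centered (x ℓ) (y ℓ) else 1) := by
          refine prod_congr rfl fun ℓ _ => ?_
          split_ifs
          · exact sum_centered_mul_centered _ _
          · simp
      _ = _ := by
          rw [prod_mul_distrib, prod_ite_mem, univ_inter]
          simp
  simp only [sq, sum_mul_sum]
  rw [sum_comm, mul_sum]
  refine sum_congr rfl fun x _ => ?_
  rw [sum_comm, mul_sum]
  exact sum_congr rfl fun y _ => key x y

theorem sum_univ_prod_centered {X : Type} [Fintype X] {n : ℕ} (z : Fin n → X)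
    {U : Finset (Fin n)} (hU : U.Nonempty) :
    ∑ x : Fin n → X, ∏ ℓ ∈ U, centered (z ℓ) (x ℓ) = 0 := by
  calc _ = ∑ x : Fin n → X, ∏ ℓ, (if ℓ ∈ U then centered (z ℓ) (x ℓ) else 1) := by
        refine sum_congr rfl fun x _ => ?_
        rw [prod_ite_mem, univ_inter]
    _ = ∏ ℓ, ∑ a : X, (if ℓ ∈ U then centered (z ℓ) a else 1) := by
        rw [Finset.prod_univ_sum, Fintype.piFinset_univ]
    _ = 0 := by
        obtain ⟨ℓ, hℓ⟩ := hU
        refine prod_eq_zero (mem_univ ℓ) ?_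
        simpa [hℓ] using sum_centered (z ℓ)

/-- A code with `B_i = 0` for `1 ≤ i < δ` averages every function of fewer than `δ` coordinates
correctly. -/
theorem sum_eq_of_mem_juntaSpan {X : Type} [Fintype X] [DecidableEq X] {n : ℕ}
    (C : Finset (Fin n → X)) {δ d : ℕ} (hd : d < δ)
    (hB : ∀ i, 1 ≤ i → i < δ →
      ∑ x ∈ C, ∑ y ∈ C, kraw (Fintype.card X) n i (hammingDist x y) = 0)
    {g : (Fin n → X) → ℝ} (hg : g ∈ juntaSpan X n d) :
    (Fintype.card X : ℝ) ^ n * ∑ x ∈ C, g x = C.card * ∑ x, g x := by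
  have hC : ∀ (U : Finset (Fin n)) (z : Fin n → X), 1 ≤ U.card → U.card < δ →
      ∑ x ∈ C, ∏ ℓ ∈ U, centered (z ℓ) (x ℓ) = 0 := by
    intro U z h1 h2
    have h := hB _ h1 h2
    simp only [← sum_powersetCard_prod_centered] at h
    rw [sum_congr rfl fun x _ => sum_comm, sum_comm] at h
    have hnn : ∀ V : Finset (Fin n),
        0 ≤ (Fintype.card X : ℝ) ^ n * ∑ x ∈ C, ∑ y ∈ C, ∏ ℓ ∈ V, centered (x ℓ) (y ℓ) :=
      fun V => sum_prod_centered_sq C V ▸ sum_nonneg fun _ _ => sq_nonneg _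
    have h' := congrArg (fun r => (Fintype.card X : ℝ) ^ n * r) h
    simp only [mul_sum (s := powersetCard _ _), mul_zero] at h'
    have h3 := (sum_eq_zero_iff_of_nonneg fun V _ => hnn V).1 h' U
      (mem_powersetCard.2 ⟨subset_univ U, rfl⟩)
    rw [← sum_prod_centered_sq, sum_eq_zero_iff_of_nonneg fun _ _ => sq_nonneg _] at h3
    exact pow_eq_zero_iff (two_ne_zero) |>.1 (h3 z (mem_univ z))
  refine Submodule.span_induction (p := fun g _ =>
    (Fintype.card X : ℝ) ^ n * ∑ x ∈ C, g x = C.card * ∑ x, g x) ?_ ?_ ?_ ?_ hg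
  · rintro g ⟨U, hU, hg⟩
    rcases isEmpty_or_nonempty (Fin n → X) with hemp | ⟨⟨x₁⟩⟩
    · simp [eq_empty_of_isEmpty C]
    have hcyl : ∀ z : Fin n → X,
        (Fintype.card X : ℝ) ^ n * ∑ x ∈ C, ∏ ℓ ∈ U, (1 + centered (z ℓ) (x ℓ)) =
          C.card * ∑ x : Fin n → X, ∏ ℓ ∈ U, (1 + centered (z ℓ) (x ℓ)) := by
      intro z
      simp only [prod_one_add]
      rw [sum_comm, sum_comm (s := univ), mul_sum, mul_sum]
      refine sum_congr rfl fun V hV => ?_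
      rcases V.eq_empty_or_nonempty with rfl | hne
      · simp [mul_comm]
      · rw [hC V z hne.card_pos ((card_le_card (mem_powerset.1 hV)).trans_lt (hU.trans_lt hd)),
          sum_univ_prod_centered z hne, mul_zero, mul_zero]
    have hrep : ∀ x : Fin n → X,
        ∑ z : Fin n → X, g z * ∏ ℓ ∈ U, (1 + centered (z ℓ) (x ℓ)) =
          (Fintype.card X : ℝ) ^ n * g x := by
      intro x
      calc _ = ∑ z : Fin n → X, g x * ∏ ℓ,
            (if ℓ ∈ U then (1 + centered (z ℓ) (x ℓ)) else 1) := by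
            refine sum_congr rfl fun z _ => ?_
            rw [prod_ite_mem, univ_inter]
            by_cases h : ∀ ℓ ∈ U, z ℓ = x ℓ
            · rw [hg h]
            · push Not at h
              obtain ⟨ℓ, hℓ, hne⟩ := h
              rw [prod_eq_zero hℓ (by simp [centered, hne]), mul_zero, mul_zero]
        _ = g x * ∏ ℓ, ∑ a : X, (if ℓ ∈ U then (1 + centered a (x ℓ)) else 1) := by
            rw [← mul_sum, Finset.prod_univ_sum, Fintype.piFinset_univ]
        _ = _ := by
            rw [mul_comm]
            congr 1
            rw [prod_congr rfl (g := fun _ => (Fintype.card X : ℝ)) fun ℓ _ => ?_]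
            · simp
            · split_ifs
              · simp [centered]
              · simp
    have hsum : ∀ D : Finset (Fin n → X), (Fintype.card X : ℝ) ^ n * ∑ x ∈ D, g x =
        ∑ z : Fin n → X, g z * ∑ x ∈ D, ∏ ℓ ∈ U, (1 + centered (z ℓ) (x ℓ)) := by
      intro D
      rw [mul_sum]
      simp only [← hrep, mul_sum]
      exact sum_comm
    have hq : (Fintype.card X : ℝ) ^ n ≠ 0 := by
      have : (Fintype.card (Fin n → X) : ℝ) ≠ 0 :=
        Nat.cast_ne_zero.2 (@Fintype.card_ne_zero _ _ ⟨x₁⟩)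
      simpa using this
    refine mul_left_cancel₀ hq ?_
    rw [mul_left_comm _ (C.card : ℝ), hsum, hsum, mul_sum, mul_sum]
    refine sum_congr rfl fun z _ => ?_
    rw [mul_left_comm, hcyl]
    ring
  · simp
  · intro f g _ _ hf hg
    simp only [Pi.add_apply, sum_add_distrib, mul_add, hf, hg]
  · intro a f _ hf
    simp only [Pi.smul_apply, smul_eq_mul, ← mul_sum]
    rw [mul_left_comm, hf, mul_left_comm]

/-! ### Compositions and supports -/

theorem sum_comp_eq_card_support {X : Type} [Fintype X] [DecidableEq X] {s : ℕ}
    (A : CommAssocScheme X s) (x₀ : X) {n : ℕ} (x : Fin n → X) :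
    ∑ i, comp A (fun _ => x₀) x i = (univ.filter fun ℓ => x ℓ ≠ x₀).card := by
  simp only [comp, card_filter]
  rw [sum_comm]
  refine sum_congr rfl fun ℓ _ => ?_
  obtain ⟨k, hk⟩ := A.rel_cover (x₀, x ℓ)
  have hk' : ∀ i, (x₀, x ℓ) ∈ A.R i ↔ i = k := by
    refine fun i => ⟨fun hi => ?_, fun hi => hi ▸ hk⟩
    by_contra hne
    exact (A.rel_disjoint i k hne).le ⟨hi, hk⟩
  have h0 : x ℓ ≠ x₀ ↔ k ≠ 0 := by
    rw [ne_eq, ne_eq, not_iff_not, eq_comm, eq_comm (a := k), ← hk', A.rel_diag]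
    rfl
  simp only [hk', h0]
  refine Fin.cases ?_ (fun j => ?_) k
  · simp [Fin.succ_ne_zero]
  · simp [Fin.succ_ne_zero]

theorem comp_comp_perm {X : Type} [Fintype X] [DecidableEq X] {s : ℕ}
    (A : CommAssocScheme X s) (x₀ : X) {n : ℕ} (x : Fin n → X) (σ : Equiv.Perm (Fin n)) :
    comp A (fun _ => x₀) (x ∘ σ) = comp A (fun _ => x₀) x := by
  ext i
  simp only [comp, card_filter, Function.comp_apply]
  exact Equiv.sum_comp σ fun ℓ => if (x₀, x ℓ) ∈ A.R i.succ then 1 else 0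

theorem comp_mem_juntaSpan {X : Type} [Fintype X] [DecidableEq X] {s : ℕ}
    (A : CommAssocScheme X s) (x₀ : X) {n : ℕ} (i : Fin s) :
    (fun x : Fin n → X => (comp A (fun _ => x₀) x i : ℝ)) ∈ juntaSpan X n 1 := by
  have h : (fun x : Fin n → X => (comp A (fun _ => x₀) x i : ℝ)) =
      ∑ ℓ, fun x => if (x₀, x ℓ) ∈ A.R i.succ then 1 else 0 := by
    ext x
    simp only [comp, card_filter, Finset.sum_apply, Nat.cast_sum, Nat.cast_ite, Nat.cast_one,
      Nat.cast_zero]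
  rw [h]
  refine Submodule.sum_mem _ fun ℓ _ => mem_juntaSpan_of_dependsOn (U := {ℓ}) (by simp) ?_
  intro x y hxy
  simp only [hxy ℓ (by simp)]

/-- The indicator of the event that the support of a word contains the coordinate `ℓ`. -/
def suppInd {X : Type} {n : ℕ} (x₀ : X) (ℓ : Fin n) (x : Fin n → X) : ℝ :=
  if x ℓ ≠ x₀ then 1 else 0

theorem suppInd_mem_juntaSpan {X : Type} {n : ℕ} (x₀ : X) (ℓ : Fin n) :
    suppInd x₀ ℓ ∈ juntaSpan X n 1 := by
  refine mem_juntaSpan_of_dependsOn (U := {ℓ}) (by simp) fun x y hxy => ?_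
  simp only [suppInd, hxy ℓ (by simp)]

theorem sum_suppInd {X : Type} {n : ℕ} (x₀ : X) (W : Finset (Fin n)) (x : Fin n → X) :
    ∑ ℓ ∈ W, suppInd x₀ ℓ x = (W.filter fun ℓ => x ℓ ≠ x₀).card := by
  simp [suppInd, card_filter]

theorem prod_suppInd {X : Type} {n : ℕ} (x₀ : X) (T : Finset (Fin n)) (x : Fin n → X) :
    ∏ ℓ ∈ T, suppInd x₀ ℓ x = if T ⊆ univ.filter (fun ℓ => x ℓ ≠ x₀) then 1 else 0 := by
  simp only [suppInd, prod_ite_zero, prod_const_one, subset_iff, mem_filter, mem_univ, true_and]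

/-- `DiffProd x₀ A p W` says that `A` is a product of `p` differences of support indicators over
disjoint pairs of coordinates, and that `W` is the set of the remaining coordinates. -/
inductive DiffProd {X : Type} {n : ℕ} (x₀ : X) :
    ((Fin n → X) → ℝ) → ℕ → Finset (Fin n) → Prop
  | one : DiffProd x₀ 1 0 univ
  | mul {A : (Fin n → X) → ℝ} {p : ℕ} {W : Finset (Fin n)} {a b : Fin n}
      (hA : DiffProd x₀ A p W) (ha : a ∈ W) (hb : b ∈ W) (hab : a ≠ b) :
      DiffProd x₀ ((suppInd x₀ a - suppInd x₀ b) * A) (p + 1) ((W.erase a).erase b)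

namespace DiffProd

variable {X : Type} {n : ℕ} {x₀ : X} {A : (Fin n → X) → ℝ} {p : ℕ} {W : Finset (Fin n)}

theorem dependsOn (hA : DiffProd x₀ A p W) : DependsOn A {ℓ | ℓ ∉ W} := by
  induction hA with
  | one => exact fun _ _ _ => rfl
  | mul hA ha hb hab ih =>
    intro x y hxy
    simp only [Pi.mul_apply, Pi.sub_apply, suppInd]
    rw [ih fun ℓ hℓ => hxy ℓ (by simp_all), hxy _ (by simp), hxy _ (by simp)]

theorem mem_juntaSpan (hA : DiffProd x₀ A p W) : A ∈ juntaSpan X n p := by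
  induction hA with
  | one => exact const_mem_juntaSpan 1
  | mul hA ha hb hab ih =>
    rw [add_comm]
    exact mul_mem_juntaSpan
      (Submodule.sub_mem _ (suppInd_mem_juntaSpan _ _) (suppInd_mem_juntaSpan _ _)) ih

theorem card_filter_of_ne_zero (hA : DiffProd x₀ A p W) {x : Fin n → X} (hx : A x ≠ 0) :
    (W.filter fun ℓ => x ℓ ≠ x₀).card + p = (univ.filter fun ℓ => x ℓ ≠ x₀).card ∧
      (W.filter fun ℓ => ¬ x ℓ ≠ x₀).card + p = (univ.filter fun ℓ => ¬ x ℓ ≠ x₀).card := by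
  induction hA with
  | one => simp
  | @mul A p W a b hA ha hb hab ih =>
    obtain ⟨h1, h2⟩ := mul_ne_zero_iff.1 hx
    obtain ⟨ih1, ih2⟩ := ih h2
    rw [← ih1, ← ih2]
    have hb' : b ∈ W.erase a := mem_erase.2 ⟨hab.symm, hb⟩
    simp only [card_filter]
    rw [← add_sum_erase W _ ha, ← add_sum_erase _ _ hb', ← add_sum_erase W _ ha,
      ← add_sum_erase _ _ hb']
    simp only [Pi.sub_apply, suppInd] at h1
    by_cases hxa : x a = x₀ <;> by_cases hxb : x b = x₀ <;> simp [hxa, hxb] at h1 ⊢ <;> omega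

theorem le_card_of_ne_zero (hA : DiffProd x₀ A p W) {x : Fin n → X} (hx : A x ≠ 0) :
    p ≤ (univ.filter fun ℓ => x ℓ ≠ x₀).card ∧
      (univ.filter fun ℓ => x ℓ ≠ x₀).card ≤ n - p := by
  obtain ⟨h1, h2⟩ := hA.card_filter_of_ne_zero hx
  have h := card_filter_add_card_filter_not (s := (univ : Finset (Fin n))) (fun ℓ => x ℓ ≠ x₀)
  rw [card_univ, Fintype.card_fin] at h
  omega

theorem sum_univ_mul_eq_zero [Fintype X] (hA : DiffProd x₀ A p W) (hp : 1 ≤ p)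
    {g : (Fin n → X) → ℝ} (hg : ∀ x (σ : Equiv.Perm (Fin n)), g (x ∘ σ) = g x) :
    ∑ x, g x * A x = 0 := by
  cases hA with
  | one => omega
  | @mul A p W a b hA ha hb hab =>
    let τ := Equiv.swap a b
    let e : (Fin n → X) ≃ (Fin n → X) := Equiv.arrowCongr τ (Equiv.refl X)
    have he : ∀ x, e x = x ∘ τ := fun x => by
      ext ℓ
      simp [e, τ]
    have h := Equiv.sum_comp e fun x => g x * ((suppInd x₀ a - suppInd x₀ b) * A) x
    have h' : ∀ x, g (e x) * ((suppInd x₀ a - suppInd x₀ b) * A) (e x) =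
        -(g x * ((suppInd x₀ a - suppInd x₀ b) * A) x) := by
      intro x
      have hAe : A (e x) = A x := hA.dependsOn fun ℓ hℓ => by
        rw [he, Function.comp_apply, Equiv.swap_apply_of_ne_of_ne]
        · rintro rfl; exact hℓ ha
        · rintro rfl; exact hℓ hb
      have ha' : suppInd x₀ a (e x) = suppInd x₀ b x := by simp [suppInd, he, τ]
      have hb' : suppInd x₀ b (e x) = suppInd x₀ a x := by simp [suppInd, he, τ]
      simp only [Pi.mul_apply, Pi.sub_apply, hAe, ha', hb']
      rw [he, hg]
      ring
    simp only [h', sum_neg_distrib] at h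
    linarith

/-- A functional on words of constant weight that kills all products of between `1` and `t`
differences also kills `A` times a product of support indicators when the total degree is at most
`t`. -/
theorem sum_mul_prod_suppInd_eq_zero (D : Finset (Fin n → X)) {k t : ℕ}
    (hD : ∀ x ∈ D, (univ.filter fun ℓ => x ℓ ≠ x₀).card = k)
    (h0 : ∀ (A : (Fin n → X) → ℝ) (p : ℕ) (W : Finset (Fin n)), DiffProd x₀ A p W →
      1 ≤ p → p ≤ t → ∑ x ∈ D, A x = 0)
    (hA : DiffProd x₀ A p W) (hp : 1 ≤ p) {U : Finset (Fin n)} (hU : U ⊆ W)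
    (hpU : p + U.card ≤ t) :
    ∑ x ∈ D, A x * ∏ ℓ ∈ U, suppInd x₀ ℓ x = 0 := by
  induction hu : U.card generalizing A p W U with
  | zero =>
    rw [card_eq_zero.1 hu]
    simpa using h0 A p W hA hp (by omega)
  | succ u ih =>
    obtain ⟨a, V, haV, rfl, hV⟩ := card_eq_succ.1 hu
    have hVW : V ⊆ W := (subset_insert _ _).trans hU
    have haW : a ∈ W := hU (mem_insert_self _ _)
    have hVsum := ih hA hp hVW (by omega) hV
    have hswap : ∀ b ∈ W \ V, ∑ x ∈ D, A x * (suppInd x₀ b x * ∏ ℓ ∈ V, suppInd x₀ ℓ x) =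
        ∑ x ∈ D, A x * (suppInd x₀ a x * ∏ ℓ ∈ V, suppInd x₀ ℓ x) := by
      intro b hb
      rw [mem_sdiff] at hb
      by_cases hab : a = b
      · rw [hab]
      have := ih (hA.mul haW hb.1 hab) (by omega) (U := V) (fun ℓ hℓ => by
        refine mem_erase.2 ⟨?_, mem_erase.2 ⟨?_, hVW hℓ⟩⟩
        · rintro rfl; exact hb.2 hℓ
        · rintro rfl; exact haV hℓ) (by omega) hV
      rw [eq_comm, ← sub_eq_zero, ← sum_sub_distrib, ← this]
      refine sum_congr rfl fun x _ => ?_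
      simp only [Pi.mul_apply, Pi.sub_apply]
      ring
    have htotal : ∑ b ∈ W \ V, ∑ x ∈ D, A x * (suppInd x₀ b x * ∏ ℓ ∈ V, suppInd x₀ ℓ x) =
        ((k : ℝ) - p - u) * ∑ x ∈ D, A x * ∏ ℓ ∈ V, suppInd x₀ ℓ x := by
      rw [sum_comm, mul_sum]
      refine sum_congr rfl fun x hx => ?_
      rw [← mul_sum, ← sum_mul]
      by_cases hAx : A x = 0
      · simp [hAx]
      by_cases hVx : ∏ ℓ ∈ V, suppInd x₀ ℓ x = 0
      · simp [hVx]
      have h1 : ∑ ℓ ∈ V, suppInd x₀ ℓ x = u := by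
        rw [sum_congr rfl (g := fun _ => (1 : ℝ)) fun ℓ hℓ => ?_]
        · simp [hV]
        · have := prod_ne_zero_iff.1 hVx ℓ hℓ
          simp only [suppInd] at this ⊢
          simp_all
      have h2 : ∑ ℓ ∈ W, suppInd x₀ ℓ x = (k : ℝ) - p := by
        have h3 := (hA.card_filter_of_ne_zero hAx).1
        rw [hD x hx] at h3
        rw [sum_suppInd, ← h3]
        push_cast
        ring
      have h4 := sum_sdiff hVW (f := fun ℓ => suppInd x₀ ℓ x)
      rw [h1, h2] at h4
      rw [show ∑ ℓ ∈ W \ V, suppInd x₀ ℓ x = (k : ℝ) - p - u by linarith]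
      ring
    rw [sum_congr rfl hswap, hVsum, mul_zero, sum_const, nsmul_eq_mul] at htotal
    simp only [prod_insert haV]
    refine (mul_eq_zero.1 htotal).resolve_left ?_
    exact Nat.cast_ne_zero.2 (card_ne_zero_of_mem (mem_sdiff.2 ⟨haW, haV⟩))

end DiffProd

/-- A function on `t`-subsets that is invariant under exchanging one element is constant. -/
theorem eq_of_forall_exchange {ι β : Type*} [DecidableEq ι] {t : ℕ} {N : Finset ι → β}
    (hN : ∀ (a b : ι) (U : Finset ι), a ≠ b → a ∉ U → b ∉ U → U.card + 1 = t →
      N (insert a U) = N (insert b U))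
    {T T' : Finset ι} (hT : T.card = t) (hT' : T'.card = t) : N T = N T' := by
  induction hk : (T \ T').card generalizing T with
  | zero =>
    rw [card_eq_zero, sdiff_eq_empty_iff_subset] at hk
    rw [eq_of_subset_of_card_le hk (by omega)]
  | succ k ih =>
    obtain ⟨a, ha⟩ := card_pos.1 (show 0 < (T \ T').card by omega)
    obtain ⟨b, hb⟩ := card_pos.1 (show 0 < (T' \ T).card by
      have := card_sdiff_add_card_inter T T'
      have := card_sdiff_add_card_inter T' T
      rw [inter_comm] at this
      omega)
    rw [mem_sdiff] at ha hb
    have hab : a ≠ b := by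
      rintro rfl
      exact hb.2 ha.1
    have hbU : b ∉ T.erase a := fun h => hb.2 (mem_of_mem_erase h)
    have hcard : (T.erase a).card + 1 = t := by rw [card_erase_add_one ha.1, hT]
    have h := hN a b (T.erase a) hab (notMem_erase a T) hbU hcard
    rw [insert_erase ha.1] at h
    rw [h]
    refine ih (by rw [card_insert_of_notMem hbU, hcard]) ?_
    have : insert b (T.erase a) \ T' = (T \ T').erase a := by
      ext ℓ
      simp only [mem_sdiff, mem_insert, mem_erase]
      constructor
      · rintro ⟨rfl | h, h'⟩
        · exact (h' hb.1).elim
        · exact ⟨h.1, h.2, h'⟩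
      · rintro ⟨h1, h2, h3⟩
        exact ⟨Or.inr ⟨h1, h2⟩, h3⟩
    rw [this, card_erase_of_mem (mem_sdiff.2 ha), hk]
    rfl

/-- If `μ` of the compositions of weight between `p` and `n - p` occurring in `C` is less than
`δ - p`, then a product of `p ≥ 1` differences sums to zero over each shell of `C`. -/
theorem sum_diffProd_filter_comp_eq_zero {X : Type} [Fintype X] [DecidableEq X] {s : ℕ}
    (A : CommAssocScheme X s) (x₀ : X) {n : ℕ} (C : Finset (Fin n → X)) (S : Set (Fin s → ℝ))
    {p δ : ℕ} (hS : S = {z | ∃ α : Fin s → ℕ, z = (fun i => (α i : ℝ)) ∧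
      p ≤ ∑ i, α i ∧ (∑ i, α i) ≤ n - p ∧ ∃ x ∈ C, comp A (fun _ => x₀) x = α})
    (hB : ∀ i, 1 ≤ i → i < δ →
      ∑ x ∈ C, ∑ y ∈ C, kraw (Fintype.card X) n i (hammingDist x y) = 0)
    (hmu : mu S + p < δ) {F : (Fin n → X) → ℝ} {W : Finset (Fin n)} (hF : DiffProd x₀ F p W)
    (hp : 1 ≤ p) (α : Fin s → ℕ) :
    ∑ x ∈ C with comp A (fun _ => x₀) x = α, F x = 0 := by
  let c : (Fin n → X) → Fin s → ℝ := fun x i => (comp A (fun _ => x₀) x i : ℝ)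
  have hfin : S.Finite := by
    refine (C.finite_toSet.image c).subset ?_
    rw [hS]
    rintro _ ⟨_, rfl, -, -, x, hx, rfl⟩
    exact ⟨x, hx, rfl⟩
  obtain ⟨g, hg, hgS⟩ :=
    exists_eval_indicator_totalDegree_le_mu hfin.toFinset (fun i => (α i : ℝ))
  rw [hfin.coe_toFinset] at hg
  have hmem := mul_mem_juntaSpan
    (eval_mem_juntaSpan (comp_mem_juntaSpan A x₀ (n := n)) g) hF.mem_juntaSpan
  have hsum := sum_eq_of_mem_juntaSpan C (by omega) hB hmem
  simp only [Pi.mul_apply] at hsum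
  rw [hF.sum_univ_mul_eq_zero hp fun x σ => by rw [comp_comp_perm], mul_zero] at hsum
  have hq : (Fintype.card X : ℝ) ^ n ≠ 0 :=
    pow_ne_zero _ (Nat.cast_ne_zero.2 (@Fintype.card_ne_zero X _ ⟨x₀⟩))
  rw [← (mul_eq_zero.1 hsum).resolve_left hq, sum_filter]
  refine sum_congr rfl fun x hx => ?_
  by_cases hFx : F x = 0
  · simp [hFx]
  have hxS : c x ∈ hfin.toFinset := by
    rw [hfin.mem_toFinset, hS]
    have h : p ≤ ∑ i, comp A (fun _ => x₀) x i ∧ ∑ i, comp A (fun _ => x₀) x i ≤ n - p := by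
      rw [sum_comp_eq_card_support]
      convert hF.le_card_of_ne_zero hFx
    exact ⟨_, rfl, h.1, h.2, x, hx, rfl⟩
  have hiff : c x = (fun i => (α i : ℝ)) ↔ comp A (fun _ => x₀) x = α := by
    simp [c, funext_iff]
  change _ = MvPolynomial.eval (c x) g * F x
  rw [hgS _ hxS]
  simp only [hiff, ite_mul, one_mul, zero_mul]

/-- **Assmus–Mattson theorem for codes over commutative association schemes.** -/
theorem assmus_mattson_scheme {X : Type} [Fintype X] [DecidableEq X] {s : ℕ} (hs : 1 ≤ s)
    (A : CommAssocScheme X s) (x₀ : X) {n : ℕ} (hn : 2 ≤ n)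
    (C : Finset (Fin n → X)) (hC1 : 1 < C.card) (hC2 : C.card < Fintype.card X ^ n)
    (S : ℕ → Set (Fin s → ℝ))
    (hS : ∀ r, S r = {z | ∃ α : Fin s → ℕ, z = (fun i => (α i : ℝ)) ∧
      r ≤ ∑ i, α i ∧ (∑ i, α i) ≤ n - r ∧ ∃ x ∈ C, comp A (fun _ => x₀) x = α})
    (B : ℕ → ℝ)
    (hB : ∀ i, B i = ∑ x ∈ C, ∑ y ∈ C, kraw (Fintype.card X) n i (hammingDist x y))
    (δs : ℕ) (hδs : δs = sInf {i | 1 ≤ i ∧ i ≤ n ∧ B i ≠ 0})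
    (t : ℕ) (ht1 : 1 ≤ t) (htn : t ≤ n)
    (hyp : ∀ r : ℕ, 1 ≤ r → r ≤ t → (mu (S r) : ℤ) < (δs : ℤ) - (r : ℤ)) :
    ∀ α : Fin s → ℕ, (∑ i, α i) ≤ n →
      ∃ lam : ℕ, ∀ T : Finset (Fin n), T.card = t →
        (C.filter fun x => comp A (fun _ => x₀) x = α ∧
          T ⊆ univ.filter fun ℓ => x ℓ ≠ x₀).card = lam := by
  have hB0 : ∀ i, 1 ≤ i → i < δs →
      ∑ x ∈ C, ∑ y ∈ C, kraw (Fintype.card X) n i (hammingDist x y) = 0 := by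
    intro i hi1 hi
    rw [← hB]
    by_contra hne
    have hpos : 0 < δs := by omega
    rw [hδs] at hpos hi
    have hin := (Nat.sInf_mem (Nat.nonempty_of_pos_sInf hpos)).2.1
    exact Nat.notMem_of_lt_sInf hi ⟨hi1, by omega, hne⟩
  intro α _
  let D := C.filter fun x => comp A (fun _ => x₀) x = α
  have hD : ∀ x ∈ D, (univ.filter fun ℓ => x ℓ ≠ x₀).card = ∑ i, α i := by
    intro x hx
    rw [← sum_comp_eq_card_support A, (mem_filter.1 hx).2]
  have h0 : ∀ (F : (Fin n → X) → ℝ) (p : ℕ) (W : Finset (Fin n)), DiffProd x₀ F p W →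
      1 ≤ p → p ≤ t → ∑ x ∈ D, F x = 0 := by
    intro F p W hF hp hpt
    have := hyp p hp hpt
    exact sum_diffProd_filter_comp_eq_zero A x₀ C (S p) (hS p) hB0 (by omega) hF hp α
  have hcount : ∀ T : Finset (Fin n),
      ((C.filter fun x => comp A (fun _ => x₀) x = α ∧
        T ⊆ univ.filter fun ℓ => x ℓ ≠ x₀).card : ℝ) = ∑ x ∈ D, ∏ ℓ ∈ T, suppInd x₀ ℓ x := by
    intro T
    simp only [prod_suppInd, sum_boole, D, filter_filter]
    congr!
  obtain ⟨T₀, -, hT₀⟩ := exists_subset_card_eq (s := (univ : Finset (Fin n))) (by simpa using htn)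
  refine ⟨_, fun T hT => eq_of_forall_exchange (N := fun T => (C.filter fun x =>
    comp A (fun _ => x₀) x = α ∧ T ⊆ univ.filter fun ℓ => x ℓ ≠ x₀).card) ?_ hT hT₀⟩
  intro a b U hab ha hb hU
  refine Nat.cast_injective (R := ℝ) ?_
  rw [hcount, hcount, ← sub_eq_zero, ← sum_sub_distrib]
  rw [← DiffProd.sum_mul_prod_suppInd_eq_zero D (fun x hx => by convert hD x hx) h0
    (DiffProd.one.mul (mem_univ a) (mem_univ b) hab) le_rfl (U := U) ?_ (by omega)]
  · refine sum_congr rfl fun x _ => ?_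
    simp only [prod_insert ha, prod_insert hb, Pi.mul_apply, Pi.sub_apply, Pi.one_apply]
    ring
  · intro ℓ hℓ
    simp only [mem_erase, mem_univ, and_true]
    exact ⟨fun h => hb (h ▸ hℓ), fun h => ha (h ▸ hℓ)⟩
end
end

section
/- Upper bound for the minimal interpolation degree via grids: Let S be a finite set of points in ℝ^s. Suppose there are real scalars z_{iℓ} (1 ≤ i ≤ s, ℓ ∈ ℕ) with z_{ik} ≠ z_{iℓ} whenever k ≠ ℓ, a positive integer m, and an invertible linear map σ : ℝ^s → ℝ^s, such that σ(S) ⊆ {(z_{1α₁}, z_{2α₂}, …, z_{sα_s}) : α = (α₁,…,α_s) ∈ ℕ^s, α₁+⋯+α_s ≤ m}. Then μ(S) ≤ m. -/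
open Finset
open scoped Classical

noncomputable section

/-- The Newton product `∏ i, ∏ k < β i, (p i - z i k)` attached to a multi-index `β`. -/
def newtonProd {s : ℕ} (p : Fin s → MvPolynomial (Fin s) ℝ) (z : Fin s → ℕ → ℝ)
    (β : Fin s → ℕ) : MvPolynomial (Fin s) ℝ :=
  ∏ i, ∏ k ∈ range (β i), (p i - MvPolynomial.C (z i k))

lemma totalDegree_newtonProd_le {s : ℕ} {p : Fin s → MvPolynomial (Fin s) ℝ}
    (hp : ∀ i, (p i).totalDegree ≤ 1) (z : Fin s → ℕ → ℝ) (β : Fin s → ℕ) :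
    (newtonProd p z β).totalDegree ≤ ∑ i, β i := by
  refine (MvPolynomial.totalDegree_finsetProd _ _).trans (sum_le_sum fun i _ => ?_)
  refine (MvPolynomial.totalDegree_finsetProd _ _).trans ?_
  refine (sum_le_card_nsmul _ _ 1 fun k _ => ?_).trans (by simp)
  exact (MvPolynomial.totalDegree_sub_C_le _ _).trans (hp i)

lemma eval_newtonProd {s : ℕ} {p : Fin s → MvPolynomial (Fin s) ℝ} {z : Fin s → ℕ → ℝ}
    {x : Fin s → ℝ} {α : Fin s → ℕ} (hx : ∀ i, MvPolynomial.eval x (p i) = z i (α i))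
    (β : Fin s → ℕ) :
    MvPolynomial.eval x (newtonProd p z β) = ∏ i, ∏ k ∈ range (β i), (z i (α i) - z i k) := by
  simp [newtonProd, hx]

lemma eval_newtonProd_eq_zero {s : ℕ} {p : Fin s → MvPolynomial (Fin s) ℝ}
    {z : Fin s → ℕ → ℝ} {x : Fin s → ℝ} {α β : Fin s → ℕ}
    (hx : ∀ i, MvPolynomial.eval x (p i) = z i (α i)) (hle : ∑ i, α i ≤ ∑ i, β i)
    (hne : α ≠ β) : MvPolynomial.eval x (newtonProd p z β) = 0 := by
  obtain ⟨i, hi⟩ : ∃ i, α i < β i := by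
    by_contra! h
    have heq : ∑ i, β i = ∑ i, α i := le_antisymm (sum_le_sum fun i _ => h i) hle
    have := (sum_eq_sum_iff_of_le fun i _ => h i).1 heq
    exact hne (funext fun i => (this i (mem_univ i)).symm)
  rw [eval_newtonProd hx]
  exact prod_eq_zero (mem_univ i) (prod_eq_zero (mem_range.2 hi) (sub_self _))

lemma eval_newtonProd_ne_zero {s : ℕ} {p : Fin s → MvPolynomial (Fin s) ℝ}
    {z : Fin s → ℕ → ℝ} (hz : ∀ i k ℓ, k ≠ ℓ → z i k ≠ z i ℓ) {x : Fin s → ℝ}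
    {α : Fin s → ℕ} (hx : ∀ i, MvPolynomial.eval x (p i) = z i (α i)) :
    MvPolynomial.eval x (newtonProd p z α) ≠ 0 := by
  rw [eval_newtonProd hx]
  refine prod_ne_zero_iff.2 fun i _ => prod_ne_zero_iff.2 fun k hk => sub_ne_zero.2 ?_
  exact hz i _ _ (mem_range.1 hk).ne'

/-- Newton interpolation: arbitrary values at the grid points of order less than `n` are
attained by a polynomial of degree at most `n - 1`. -/
lemma exists_totalDegree_le_interpolating {s : ℕ} {p : Fin s → MvPolynomial (Fin s) ℝ}
    (hp : ∀ i, (p i).totalDegree ≤ 1) {z : Fin s → ℕ → ℝ}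
    (hz : ∀ i k ℓ, k ≠ ℓ → z i k ≠ z i ℓ) {x : (Fin s → ℕ) → Fin s → ℝ}
    (hx : ∀ α i, MvPolynomial.eval (x α) (p i) = z i (α i)) (φ : (Fin s → ℕ) → ℝ) (n : ℕ) :
    ∃ h : MvPolynomial (Fin s) ℝ, h.totalDegree ≤ n - 1 ∧
      ∀ α : Fin s → ℕ, ∑ i, α i < n → MvPolynomial.eval (x α) h = φ α := by
  induction n with
  | zero => exact ⟨0, by simp, by simp⟩
  | succ n ih =>
    obtain ⟨h, hdeg, hval⟩ := ih
    let c : (Fin s → ℕ) → ℝ := fun β =>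
      (φ β - MvPolynomial.eval (x β) h) / MvPolynomial.eval (x β) (newtonProd p z β)
    refine ⟨h + ∑ β ∈ piAntidiag univ n, MvPolynomial.C (c β) * newtonProd p z β, ?_, ?_⟩
    · refine (MvPolynomial.totalDegree_add _ _).trans (max_le (by omega) ?_)
      refine MvPolynomial.totalDegree_finsetSum_le fun β hβ => ?_
      refine (MvPolynomial.totalDegree_mul _ _).trans ?_
      rw [MvPolynomial.totalDegree_C, zero_add]
      exact (totalDegree_newtonProd_le hp z β).trans (mem_piAntidiag.1 hβ).1.le
    · intro α hα
      have hvanish : ∀ β ∈ piAntidiag (univ : Finset (Fin s)) n, β ≠ α →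
          c β * MvPolynomial.eval (x α) (newtonProd p z β) = 0 := fun β hβ hne => by
        rw [eval_newtonProd_eq_zero (hx α) _ hne.symm, mul_zero]
        exact (Nat.lt_succ_iff.1 hα).trans (mem_piAntidiag.1 hβ).1.ge
      simp only [map_add, map_sum, map_mul, MvPolynomial.eval_C]
      rcases (Nat.lt_succ_iff.1 hα).lt_or_eq with hlt | heq
      · rw [sum_eq_zero, add_zero, hval α hlt]
        refine fun β hβ => hvanish β hβ ?_
        rintro rfl
        exact hlt.ne (mem_piAntidiag.1 hβ).1
      · rw [sum_eq_single_of_mem α (mem_piAntidiag.2 ⟨heq, by simp⟩) hvanish,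
          div_mul_cancel₀ _ (eval_newtonProd_ne_zero hz (hx α))]
        ring

/-- The coordinates of a linear map are given by polynomials of degree at most one. -/
lemma exists_totalDegree_le_one_eval_eq {s : ℕ} (φ : (Fin s → ℝ) →ₗ[ℝ] ℝ) :
    ∃ p : MvPolynomial (Fin s) ℝ, p.totalDegree ≤ 1 ∧ ∀ x, MvPolynomial.eval x p = φ x := by
  refine ⟨∑ j, MvPolynomial.C (φ (Pi.single j 1)) * MvPolynomial.X j, ?_, fun x => ?_⟩
  · refine MvPolynomial.totalDegree_finsetSum_le fun j _ => ?_
    refine (MvPolynomial.totalDegree_mul _ _).trans ?_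
    simp
  · conv_rhs => rw [← univ_sum_single x, map_sum]
    simp only [map_sum, map_mul, MvPolynomial.eval_C, MvPolynomial.eval_X]
    refine sum_congr rfl fun j _ => ?_
    rw [mul_comm, ← smul_eq_mul, ← map_smul, ← Pi.single_smul, smul_eq_mul, mul_one]

/-- **Upper bound for the minimal interpolation degree via grids** (Supplement 3.4). -/
theorem mu_le_of_grid {s : ℕ} (S : Set (Fin s → ℝ)) (hS : S.Finite)
    (z : Fin s → ℕ → ℝ) (hz : ∀ i k ℓ, k ≠ ℓ → z i k ≠ z i ℓ)
    (m : ℕ) (hm : 0 < m) (σ : (Fin s → ℝ) ≃ₗ[ℝ] (Fin s → ℝ))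
    (hσ : σ '' S ⊆
      {p | ∃ α : Fin s → ℕ, (∑ i, α i) ≤ m ∧ p = fun i => z i (α i)}) :
    mu S ≤ m := by
  choose p hp hpe using fun i => exists_totalDegree_le_one_eval_eq
    (LinearMap.proj i ∘ₗ σ.toLinearMap)
  let x : (Fin s → ℕ) → Fin s → ℝ := fun α => σ.symm fun i => z i (α i)
  have hx : ∀ α i, MvPolynomial.eval (x α) (p i) = z i (α i) := fun α i => by simp [hpe, x]
  refine csSup_le' ?_
  rintro _ ⟨L, hL, rfl⟩
  refine csSup_le' ?_
  rintro _ ⟨g, hg, rfl⟩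
  obtain ⟨h, hdeg, hval⟩ := exists_totalDegree_le_interpolating hp hz hx
    (fun α => MvPolynomial.eval (x α) g) (m + 1)
  refine (hL.2 h g hg fun y hy => ?_).trans hdeg
  obtain ⟨α, hα, hy'⟩ := hσ ⟨y, hy, rfl⟩
  have hyx : y = x α := (σ.symm_apply_apply y).symm.trans (congrArg σ.symm hy')
  rw [hyx, hval α (Nat.lt_succ_iff.2 hα)]
end
end
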